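/- arXiv:2302.01750 — 2 statements merged into one kernel-verified Lean document; each statement's English description precedes it below -/
import Mathlib

section
/- For all integers n ≥ 0, A_{5,3}(125n + 122) ≡ 0 (mod 25). -/
/-- Hook length of the cell in row `i`, column `j` (0-indexed) of the
Ferrers–Young diagram of the partition `p` (rows sorted in decreasing order). -/
def hookLength {n : ℕ} (p : n.Partition) (i j : ℕ) : ℕ :=
  (((p.parts.sort (· ≤ ·)).reverse.getD i 0 - j) +
    ((p.parts.filter (fun x => j < x)).card - i)) - 1

/-- A partition is a `t`-core if no hook number of its Ferrers–Young diagram is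
divisible by `t`. -/
def IsTCore (t : ℕ) {n : ℕ} (p : n.Partition) : Prop :=
  ∀ i j : ℕ, j < (p.parts.sort (· ≤ ·)).reverse.getD i 0 → ¬ t ∣ hookLength p i j

/-- `numA t k n` is the number of `k`-tuples of `t`-core partitions whose sizes sum to `n`. -/
noncomputable def numA (t k n : ℕ) : ℕ :=
  Nat.card { f : Fin k → Σ m : Fin (n + 1), Nat.Partition (m : ℕ) //
    (∑ i, ((f i).1 : ℕ)) = n ∧ ∀ i, IsTCore t (f i).2 }

section
open PowerSeries

theorem X_pow_dvd_prod_one_sub_X_pow_sub_one (R : Type*) [CommRing R] (m : ℕ) (s : Finset ℕ)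
    (hs : ∀ i ∈ s, m ≤ i) : (X : R⟦X⟧) ^ (m + 1) ∣ ∏ i ∈ s, (1 - X ^ (i + 1)) - 1 := by
  classical
  induction s using Finset.induction_on with
  | empty => simp
  | insert a s ha ih =>
    rw [Finset.prod_insert ha]
    obtain ⟨c, hc⟩ := ih fun i hi => hs i (Finset.mem_insert_of_mem hi)
    obtain ⟨d, hd⟩ : (X : R⟦X⟧) ^ (m + 1) ∣ X ^ (a + 1) :=
      pow_dvd_pow _ (by have := hs a (Finset.mem_insert_self _ _); omega)
    refine ⟨c - d * ∏ i ∈ s, (1 - X ^ (i + 1)), ?_⟩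
    rw [mul_sub, ← hc, ← mul_assoc, ← hd]
    ring

theorem X_pow_dvd_pentagonalSeries_sub_prod (R : Type*) [CommRing R] (m : ℕ) :
    (X : R⟦X⟧) ^ (m + 1) ∣ pentagonalSeries R - ∏ i ∈ Finset.range m, (1 - X ^ (i + 1)) := by
  rw [X_pow_dvd_iff]
  intro j hj
  obtain ⟨s, hs, hs'⟩ := ((coeff_prod_one_sub_X_pow_eventually_eq R j).and
    (Filter.eventually_ge_atTop (Finset.range m))).exists
  rw [map_sub, ← hs, ← map_sub]
  have h : (X : R⟦X⟧) ^ (m + 1) ∣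
      ∏ i ∈ s, (1 - X ^ (i + 1)) - ∏ i ∈ Finset.range m, (1 - X ^ (i + 1)) := by
    rw [← Finset.prod_sdiff hs', ← sub_one_mul]
    exact (X_pow_dvd_prod_one_sub_X_pow_sub_one R m _ fun i hi => by simpa using
      (Finset.mem_sdiff.mp hi).2).mul_right _
  exact X_pow_dvd_iff.mp h j hj

/-- The part of Euler's pentagonal series indexed by integers congruent to `r` modulo `5`. -/
noncomputable def pentagonalPart (R : Type*) [CommRing R] (r : ℤ) : R⟦X⟧ :=
  .mk fun n => ∑ k ∈ Finset.Icc (-n : ℤ) n,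
    if pentagonal k = n ∧ k % 5 = r then ((Int.negOnePow k : ℤ) : R) else 0

theorem abs_le_pentagonal (k : ℤ) : k ∈ Finset.Icc (-(pentagonal k) : ℤ) (pentagonal k) := by
  have h := two_mul_natCast_pentagonal k
  rw [Finset.mem_Icc]
  rcases lt_trichotomy k 0 with hk | rfl | hk
  · constructor <;> nlinarith
  · simp
  · constructor <;> nlinarith

theorem coeff_pentagonalPart_eq (R : Type*) [CommRing R] (r : ℤ) (n : ℕ) (N : ℤ) (hN : n ≤ N) :
    coeff n (pentagonalPart R r) = ∑ k ∈ Finset.Icc (-N) N,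
      if pentagonal k = n ∧ k % 5 = r then ((Int.negOnePow k : ℤ) : R) else 0 := by
  rw [pentagonalPart, coeff_mk]
  apply Finset.sum_subset
  · intro k; simp only [Finset.mem_Icc]; omega
  · intro k _ hk
    rw [if_neg]
    rintro ⟨rfl, _⟩
    exact hk (abs_le_pentagonal k)

theorem pentagonalSeries_eq_sum_parts (R : Type*) [CommRing R] :
    pentagonalSeries R = pentagonalPart R 0 + pentagonalPart R 1 + pentagonalPart R 2 +
      pentagonalPart R 3 + pentagonalPart R 4 := by
  ext n
  simp only [map_add, pentagonalPart, coeff_mk, ← Finset.sum_add_distrib]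
  trans ∑ k ∈ Finset.Icc (-n : ℤ) n, if pentagonal k = n then ((Int.negOnePow k : ℤ) : R) else 0
  · by_cases h : ∃ k, pentagonal k = n
    · obtain ⟨k, rfl⟩ := h
      rw [Finset.sum_eq_single_of_mem k (abs_le_pentagonal k)]
      · simp
      · intro b _ hb
        rw [if_neg (fun h => hb (pentagonal_injective h))]
    · rw [coeff_pentagonalSeries_eq_zero R (by simpa using h), Finset.sum_eq_zero]
      intro k _
      rw [if_neg (fun hk => h ⟨k, hk⟩)]
  · refine Finset.sum_congr rfl fun k _ => ?_
    have : k % 5 = 0 ∨ k % 5 = 1 ∨ k % 5 = 2 ∨ k % 5 = 3 ∨ k % 5 = 4 := by omega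
    by_cases hp : pentagonal k = n
    · rcases this with h | h | h | h | h <;> simp [hp, h]
    · simp [hp]

theorem pentagonal_mod_five (k : ℤ) : (pentagonal k : ℤ) % 5 =
    if k % 5 = 1 then 1 else if k % 5 = 0 ∨ k % 5 = 2 then 0 else 2 := by
  have h := two_mul_natCast_pentagonal k
  obtain ⟨q, s, hs, hs', rfl⟩ : ∃ q s, 0 ≤ s ∧ s < 5 ∧ k = 5 * q + s :=
    ⟨k / 5, k % 5, by omega, by omega, by omega⟩
  have h2 : 2 * (pentagonal (5 * q + s) : ℤ) =
      5 * (15 * q ^ 2 + 6 * q * s - q) + s * (3 * s - 1) := by rw [h]; ring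
  interval_cases s <;> omega

/-- Power series supported on exponents congruent to `r` modulo `5`. -/
def SupportedMod {R : Type*} [CommRing R] (r : ℕ) (f : R⟦X⟧) : Prop :=
  ∀ n, n % 5 ≠ r % 5 → coeff n f = 0

theorem supportedMod_pentagonalPart (R : Type*) [CommRing R] (r : ℤ) (s : ℕ)
    (h : ∀ k : ℤ, k % 5 = r → (pentagonal k : ℤ) % 5 = s % 5) :
    SupportedMod s (pentagonalPart R r) := by
  intro n hn
  rw [pentagonalPart, coeff_mk, Finset.sum_eq_zero]
  intro k _
  rw [if_neg]
  rintro ⟨rfl, hk⟩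
  have := h k hk
  omega

theorem pentagonal_five_mul_add_one (l : ℤ) :
    pentagonal (5 * l + 1) = 25 * pentagonal (-l) + 1 := by
  have h1 := two_mul_natCast_pentagonal (5 * l + 1)
  have h2 := two_mul_natCast_pentagonal (-l)
  zify
  linarith

theorem pentagonalPart_one (R : Type*) [CommRing R] :
    pentagonalPart R 1 = -(X * expand 25 (by norm_num) (pentagonalSeries R)) := by
  ext n
  by_cases h : ∃ l : ℤ, pentagonal (5 * l + 1) = n
  · obtain ⟨l, rfl⟩ := h
    rw [map_neg, pentagonal_five_mul_add_one, coeff_succ_X_mul, coeff_expand_mul,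
      coeff_pentagonalSeries_pentagonal, ← pentagonal_five_mul_add_one, pentagonalPart, coeff_mk,
      Finset.sum_eq_single_of_mem (5 * l + 1) (abs_le_pentagonal _)]
    · rw [if_pos ⟨rfl, by omega⟩]
      have : Int.negOnePow (5 * l + 1) = -Int.negOnePow (-l) := by
        rw [show 5 * l + 1 = -l + (2 * (3 * l) + 1) by ring, Int.negOnePow_add,
          Int.negOnePow_two_mul_add_one, mul_neg_one]
      rw [this]
      simp
    · intro b _ hb
      rw [if_neg (fun h => hb (pentagonal_injective h.1))]
  · trans 0
    · rw [pentagonalPart, coeff_mk, Finset.sum_eq_zero]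
      intro k _
      rw [if_neg]
      rintro ⟨hk, hk'⟩
      exact h ⟨k / 5, by rw [← hk]; congr 1; omega⟩
    · rw [map_neg, eq_comm, neg_eq_zero]
      rcases n with _ | n
      · simp
      rw [coeff_succ_X_mul, coeff_expand]
      split_ifs with h25
      · apply coeff_pentagonalSeries_eq_zero
        rintro ⟨l, hl⟩
        exact h ⟨-l, by rw [pentagonal_five_mul_add_one, neg_neg, hl]; omega⟩
      · rfl

theorem coeff_pentagonalPart_mul (R : Type*) [CommRing R] (r s : ℤ) (n : ℕ) :
    coeff n (pentagonalPart R r * pentagonalPart R s) =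
      ∑ z ∈ (Finset.Icc (-n : ℤ) n ×ˢ Finset.Icc (-n : ℤ) n).filter
        (fun z => pentagonal z.1 + pentagonal z.2 = n),
        if z.1 % 5 = r ∧ z.2 % 5 = s then ((Int.negOnePow (z.1 + z.2) : ℤ) : R) else 0 := by
  rw [coeff_mul]
  have h : ∀ x ∈ Finset.HasAntidiagonal.antidiagonal n,
      coeff x.1 (pentagonalPart R r) * coeff x.2 (pentagonalPart R s) =
      ∑ z ∈ Finset.Icc (-n : ℤ) n ×ˢ Finset.Icc (-n : ℤ) n,
        if (pentagonal z.1, pentagonal z.2) = x then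
          if z.1 % 5 = r ∧ z.2 % 5 = s then ((Int.negOnePow (z.1 + z.2) : ℤ) : R) else 0
        else 0 := by
    intro x hx
    rw [Finset.HasAntidiagonal.mem_antidiagonal] at hx
    rw [coeff_pentagonalPart_eq R r x.1 n (by omega), coeff_pentagonalPart_eq R s x.2 n (by omega),
      Finset.sum_mul_sum, ← Finset.sum_product']
    refine Finset.sum_congr rfl fun z _ => ?_
    simp only [Prod.ext_iff]
    by_cases h1 : pentagonal z.1 = x.1 <;> by_cases h2 : pentagonal z.2 = x.2 <;>
    by_cases h3 : z.1 % 5 = r <;> by_cases h4 : z.2 % 5 = s <;>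
    simp [h1, h2, h3, h4, Int.negOnePow_add]
  rw [Finset.sum_congr rfl h, Finset.sum_comm, Finset.sum_filter]
  refine Finset.sum_congr rfl fun z _ => ?_
  rw [Finset.sum_ite_eq]
  simp only [Finset.HasAntidiagonal.mem_antidiagonal]

theorem pentagonalPart_mul_relation (R : Type*) [CommRing R] :
    pentagonalPart R 0 * pentagonalPart R 4 + pentagonalPart R 1 * pentagonalPart R 1 +
      pentagonalPart R 2 * pentagonalPart R 3 + pentagonalPart R 3 * pentagonalPart R 0 +
      pentagonalPart R 4 * pentagonalPart R 2 = 0 := by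
  ext n
  simp only [map_add, coeff_pentagonalPart_mul, map_zero, ← Finset.sum_add_distrib]
  trans ∑ z ∈ (Finset.Icc (-n : ℤ) n ×ˢ Finset.Icc (-n : ℤ) n).filter
        (fun z => pentagonal z.1 + pentagonal z.2 = n ∧ (z.2 - 2 * z.1 + 1) % 5 = 0),
          ((Int.negOnePow (z.1 + z.2) : ℤ) : R)
  · rw [← Finset.filter_filter, Finset.sum_filter _ (s := Finset.filter _ _)]
    refine Finset.sum_congr rfl fun z _ => ?_
    have h1 : z.1 % 5 = 0 ∨ z.1 % 5 = 1 ∨ z.1 % 5 = 2 ∨ z.1 % 5 = 3 ∨ z.1 % 5 = 4 := by omega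
    have h2 : z.2 % 5 = 0 ∨ z.2 % 5 = 1 ∨ z.2 % 5 = 2 ∨ z.2 % 5 = 3 ∨ z.2 % 5 = 4 := by omega
    by_cases h : (z.2 - 2 * z.1 + 1) % 5 = 0
    · rw [if_pos h]
      rcases h1 with h1 | h1 | h1 | h1 | h1 <;> rcases h2 with h2 | h2 | h2 | h2 | h2 <;>
        first | (exfalso; omega) | simp [h1, h2]
    · rw [if_neg h]
      rcases h1 with h1 | h1 | h1 | h1 | h1 <;> rcases h2 with h2 | h2 | h2 | h2 | h2 <;>
        first | (exfalso; omega) | simp [h1, h2]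
  · have key : ∀ k l u : ℤ, l = 2 * k - 1 + 5 * u →
        pentagonal (1 - k - 4 * u) + pentagonal (1 - 2 * k - 3 * u) =
          pentagonal k + pentagonal l := by
      rintro k l u rfl
      have h1 := two_mul_natCast_pentagonal (1 - k - 4 * u)
      have h2 := two_mul_natCast_pentagonal (1 - 2 * k - 3 * u)
      have h3 := two_mul_natCast_pentagonal k
      have h4 := two_mul_natCast_pentagonal (2 * k - 1 + 5 * u)
      zify
      linarith
    refine Finset.sum_involution (fun z _ => (1 - z.1 - 4 * ((z.2 - 2 * z.1 + 1) / 5),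
      1 - 2 * z.1 - 3 * ((z.2 - 2 * z.1 + 1) / 5))) ?_ ?_ ?_ ?_
    · rintro ⟨k, l⟩ hz
      simp only [Finset.mem_filter] at hz
      obtain ⟨u, hu⟩ := Int.dvd_of_emod_eq_zero hz.2.2
      have hl : l = 2 * k - 1 + 5 * u := by linarith
      subst hl
      simp only [hu]
      rw [Int.mul_ediv_cancel_left _ (by norm_num)]
      have : (1 - k - 4 * u + (1 - 2 * k - 3 * u)) = (k + (2 * k - 1 + 5 * u)) +
        (2 * (-3 * k - 6 * u + 1) + 1) := by ring
      rw [this, Int.negOnePow_add _ (2 * _ + 1), Int.negOnePow_succ]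
      simp
    · rintro ⟨k, l⟩ hz _ heq
      simp only [Finset.mem_filter, Prod.mk.injEq] at hz heq
      omega
    · rintro ⟨k, l⟩ hz
      simp only [Finset.mem_filter, Finset.mem_product] at hz ⊢
      obtain ⟨u, hu⟩ := Int.dvd_of_emod_eq_zero hz.2.2
      have hl : l = 2 * k - 1 + 5 * u := by linarith
      have hk := key k l u hl
      rw [hu, Int.mul_ediv_cancel_left _ (by norm_num)]
      rw [hz.2.1] at hk
      have b1 := abs_le_pentagonal (1 - k - 4 * u)
      have b2 := abs_le_pentagonal (1 - 2 * k - 3 * u)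
      rw [Finset.mem_Icc] at b1 b2
      simp only [Finset.mem_Icc]
      refine ⟨⟨⟨?_, ?_⟩, ?_, ?_⟩, hk, ?_⟩ <;> omega
    · rintro ⟨k, l⟩ hz
      simp only [Finset.mem_filter, Prod.mk.injEq] at hz ⊢
      omega

theorem prod_one_sub_fifth_root {S : Type*} [CommRing S] (w T : S)
    (hw : 1 + w + w ^ 2 + w ^ 3 + w ^ 4 = 0) :
    ∏ j ∈ Finset.range 5, (1 - w ^ j * T) = 1 - T ^ 5 := by
  simp only [Finset.prod_range_succ, Finset.prod_range_zero]
  grind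

theorem prod_trinomial_fifth_root {S : Type*} [CommRing S] (w a b c : S)
    (hw : 1 + w + w ^ 2 + w ^ 3 + w ^ 4 = 0) :
    ∏ j ∈ Finset.range 5, (a + w ^ j * b + (w ^ j) ^ 2 * c) =
      a ^ 5 + b ^ 5 + c ^ 5 - 5 * a * b ^ 3 * c + 5 * a ^ 2 * b * c ^ 2 := by
  have h5 : w ^ 5 = 1 := by linear_combination (w - 1) * hw
  have h6 : (w ^ 3) ^ 2 = w := by linear_combination w * h5
  have h8 : (w ^ 4) ^ 2 = w ^ 3 := by linear_combination w ^ 3 * h5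
  simp only [Finset.prod_range_succ, Finset.prod_range_zero, h6, h8]
  grind

section
variable {R : Type*} [CommRing R]

theorem X_pow_dvd_rescale_sub (z : R) {m : ℕ} {f g : R⟦X⟧} (h : X ^ m ∣ f - g) :
    X ^ m ∣ rescale z f - rescale z g := by
  rw [X_pow_dvd_iff] at h ⊢
  intro i hi
  rw [← map_sub, coeff_rescale, h i hi, mul_zero]

theorem X_pow_dvd_expand_sub (p : ℕ) (hp : p ≠ 0) {m : ℕ} {f g : R⟦X⟧} (h : X ^ m ∣ f - g) :
    X ^ m ∣ expand p hp f - expand p hp g := by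
  obtain ⟨c, hc⟩ := h
  rw [← map_sub, hc, map_mul, map_pow, expand_X, ← pow_mul, mul_comm p m, pow_mul]
  exact (dvd_pow_self _ hp).mul_right _

theorem prod_rescale_one_sub_X_pow (z : R) (hz : 1 + z + z ^ 2 + z ^ 3 + z ^ 4 = 0) (i : ℕ) :
    ∏ j ∈ Finset.range 5, rescale (z ^ j) (1 - X ^ i : R⟦X⟧) =
      if 5 ∣ i then (1 - X ^ i) ^ 5 else 1 - X ^ (5 * i) := by
  have h5 : z ^ 5 = 1 := by linear_combination (z - 1) * hz
  split_ifs with h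
  · obtain ⟨k, rfl⟩ := h
    rw [← Finset.card_range 5, ← Finset.prod_const, Finset.card_range]
    refine Finset.prod_congr rfl fun j _ => ?_
    rw [map_sub, map_one, map_pow, rescale_X, mul_pow, ← map_pow, ← pow_mul,
      show j * (5 * k) = 5 * (j * k) by ring, pow_mul, h5, one_pow, map_one, one_mul]
  · have hw : 1 + (C (z ^ i) : R⟦X⟧) + C (z ^ i) ^ 2 + C (z ^ i) ^ 3 + C (z ^ i) ^ 4 = 0 := by
      simp only [← map_pow, ← map_add, ← map_one (C (R := R))]
      rw [← map_zero (C (R := R))]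
      congr 1
      have hi : z ^ i = z ^ (i % 5) := by
        conv_lhs => rw [← Nat.div_add_mod i 5, pow_add, pow_mul, h5, one_pow, one_mul]
      rw [hi]
      have : i % 5 = 1 ∨ i % 5 = 2 ∨ i % 5 = 3 ∨ i % 5 = 4 := by omega
      rcases this with h | h | h | h <;> rw [h] <;> grind
    rw [mul_comm 5 i, pow_mul, ← prod_one_sub_fifth_root _ _ hw]
    refine Finset.prod_congr rfl fun j _ => ?_
    rw [map_sub, map_one, map_pow, rescale_X, mul_pow, ← map_pow, ← map_pow, ← pow_mul, ← pow_mul,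
      mul_comm i j]

theorem prod_rescale_euler (z : R) (hz : 1 + z + z ^ 2 + z ^ 3 + z ^ 4 = 0) (n : ℕ) :
    (∏ j ∈ Finset.range 5, rescale (z ^ j) (∏ i ∈ Finset.range (5 * n), (1 - X ^ (i + 1)) : R⟦X⟧)) *
      expand 25 (by norm_num) (∏ i ∈ Finset.range n, (1 - X ^ (i + 1)) : R⟦X⟧) =
    expand 5 (by norm_num) (∏ i ∈ Finset.range (5 * n), (1 - X ^ (i + 1)) : R⟦X⟧) *
      expand 5 (by norm_num) (∏ i ∈ Finset.range n, (1 - X ^ (i + 1)) : R⟦X⟧) ^ 5 := by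
  induction n with
  | zero => simp
  | succ n ih =>
    have e : ∀ f : ℕ → R⟦X⟧, ∏ i ∈ Finset.range (5 * (n + 1)), f i =
        (∏ i ∈ Finset.range (5 * n), f i) * f (5 * n) * f (5 * n + 1) * f (5 * n + 2) *
          f (5 * n + 3) * f (5 * n + 4) := by
      intro f
      rw [show 5 * (n + 1) = 5 * n + 1 + 1 + 1 + 1 + 1 by ring]
      simp only [Finset.prod_range_succ]
    simp only [e, Finset.prod_range_succ _ n, map_mul, Finset.prod_mul_distrib,
      prod_rescale_one_sub_X_pow z hz]
    rw [if_neg (by omega), if_neg (by omega), if_neg (by omega), if_neg (by omega),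
      if_pos (by omega)]
    simp only [map_sub, map_one, map_pow, expand_X, ← pow_mul]
    rw [show 5 * n + 4 + 1 = 5 * (n + 1) by ring]
    rw [show 25 * (n + 1) = 5 * (5 * (n + 1)) by ring]
    linear_combination (1 - X ^ (5 * (5 * n + 1))) * (1 - X ^ (5 * (5 * n + 1 + 1))) *
      (1 - X ^ (5 * (5 * n + 2 + 1))) * (1 - X ^ (5 * (5 * n + 3 + 1))) *
      (1 - X ^ (5 * (n + 1))) ^ 5 * (1 - X ^ (5 * (5 * (n + 1)))) * ih

theorem prod_rescale_pentagonalSeries (z : R) (hz : 1 + z + z ^ 2 + z ^ 3 + z ^ 4 = 0) :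
    (∏ j ∈ Finset.range 5, rescale (z ^ j) (pentagonalSeries R)) *
      expand 25 (by norm_num) (pentagonalSeries R) =
    expand 5 (by norm_num) (pentagonalSeries R) ^ 6 := by
  rw [← sub_eq_zero]
  ext m
  revert m
  suffices h : ∀ m, (X : R⟦X⟧) ^ (m + 1) ∣ (∏ j ∈ Finset.range 5, rescale (z ^ j)
      (pentagonalSeries R)) * expand 25 (by norm_num) (pentagonalSeries R) -
        expand 5 (by norm_num) (pentagonalSeries R) ^ 6 by
    intro m
    rw [X_pow_dvd_iff.mp (h m) m (Nat.lt_succ_self m), map_zero]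
  intro m
  have h1 := X_pow_dvd_pentagonalSeries_sub_prod R m
  have h5 := (pow_dvd_pow (X : R⟦X⟧) (show m + 1 ≤ 5 * m + 1 by omega)).trans
    (X_pow_dvd_pentagonalSeries_sub_prod R (5 * m))
  have key := prod_rescale_euler z hz m
  set I := Ideal.span {(X : R⟦X⟧) ^ (m + 1)}
  have hI : ∀ f g : R⟦X⟧, X ^ (m + 1) ∣ f - g ↔ Ideal.Quotient.mk I f = Ideal.Quotient.mk I g :=
    fun f g => by rw [Ideal.Quotient.eq, Ideal.mem_span_singleton]
  have e25 := (hI _ _).mp (X_pow_dvd_expand_sub 25 (by norm_num) h1)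
  have e5 := (hI _ _).mp (X_pow_dvd_expand_sub 5 (by norm_num) h1)
  have e5' := (hI _ _).mp (X_pow_dvd_expand_sub 5 (by norm_num) h5)
  have er := fun j => (hI _ _).mp (X_pow_dvd_rescale_sub (z ^ j) h5)
  rw [hI, map_mul, map_prod, e25, Finset.prod_congr rfl (fun j _ => er j), ← map_prod, ← map_mul,
    key, map_mul, ← e5', map_pow, ← e5, ← map_pow, ← map_mul]
  congr 1
  ring

theorem rescale_of_supportedMod (z : R) (hz : z ^ 5 = 1) {r : ℕ} {f : R⟦X⟧}
    (hf : SupportedMod r f) : rescale z f = C (z ^ r) * f := by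
  ext n
  rw [coeff_rescale, coeff_C_mul]
  by_cases h : n % 5 = r % 5
  · congr 1
    rw [← Nat.div_add_mod n 5, ← Nat.div_add_mod r 5, h, pow_add, pow_add, pow_mul, pow_mul, hz,
      one_pow, one_pow]
  · rw [hf n h, mul_zero, mul_zero]

end

theorem map_pentagonalSeries {R S : Type*} [CommRing R] [CommRing S] (φ : R →+* S) :
    map φ (pentagonalSeries R) = pentagonalSeries S := by
  ext n
  rw [coeff_map]
  by_cases h : n ∈ Set.range pentagonal
  · obtain ⟨k, rfl⟩ := h
    simp
  · rw [coeff_pentagonalSeries_eq_zero R h, coeff_pentagonalSeries_eq_zero S h, map_zero]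

theorem map_pentagonalPart {R S : Type*} [CommRing R] [CommRing S] (φ : R →+* S) (r : ℤ) :
    map φ (pentagonalPart R r) = pentagonalPart S r := by
  ext n
  simp only [coeff_map, pentagonalPart, coeff_mk, map_sum, apply_ite φ, map_intCast, map_zero]

theorem SupportedMod.add {R : Type*} [CommRing R] {r : ℕ} {f g : R⟦X⟧} (hf : SupportedMod r f)
    (hg : SupportedMod r g) : SupportedMod r (f + g) := fun n hn => by
  rw [map_add, hf n hn, hg n hn, add_zero]

theorem supportedMod_zero_parts (R : Type*) [CommRing R] :
    SupportedMod 0 (pentagonalPart R 0 + pentagonalPart R 2) := by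
  refine .add ?_ ?_ <;> refine supportedMod_pentagonalPart R _ _ fun k hk => ?_ <;>
  simp [pentagonal_mod_five, hk]

theorem supportedMod_one_part (R : Type*) [CommRing R] :
    SupportedMod 1 (pentagonalPart R 1) := by
  refine supportedMod_pentagonalPart R _ _ fun k hk => ?_
  simp [pentagonal_mod_five, hk]

theorem supportedMod_two_parts (R : Type*) [CommRing R] :
    SupportedMod 2 (pentagonalPart R 3 + pentagonalPart R 4) := by
  refine .add ?_ ?_ <;> refine supportedMod_pentagonalPart R _ _ fun k hk => ?_ <;>
  simp [pentagonal_mod_five, hk]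

theorem parts_mul_eq_neg_sq (R : Type*) [CommRing R] :
    (pentagonalPart R 0 + pentagonalPart R 2) * (pentagonalPart R 3 + pentagonalPart R 4) =
      -pentagonalPart R 1 ^ 2 := by
  linear_combination pentagonalPart_mul_relation R

theorem pentagonalPart_norm_complex :
    ((pentagonalPart ℂ 0 + pentagonalPart ℂ 2) ^ 5 + (pentagonalPart ℂ 3 + pentagonalPart ℂ 4) ^ 5
      + 11 * pentagonalPart ℂ 1 ^ 5) * expand 25 (by norm_num) (pentagonalSeries ℂ) =
        expand 5 (by norm_num) (pentagonalSeries ℂ) ^ 6 := by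
  have hprim := Complex.isPrimitiveRoot_exp 5 (by norm_num)
  set z := Complex.exp (2 * Real.pi * Complex.I / (5 : ℕ))
  have hz : 1 + z + z ^ 2 + z ^ 3 + z ^ 4 = 0 := by
    have := hprim.geom_sum_eq_zero (by norm_num)
    simpa [Finset.sum_range_succ] using this
  have hC : 1 + (C z : ℂ⟦X⟧) + C z ^ 2 + C z ^ 3 + C z ^ 4 = 0 := by
    simp only [← map_pow, ← map_add, ← map_one (C (R := ℂ)), hz, map_zero]
  rw [← prod_rescale_pentagonalSeries z hz]
  congr 1
  have hj : ∀ j ∈ Finset.range 5, rescale (z ^ j) (pentagonalSeries ℂ) =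
      (pentagonalPart ℂ 0 + pentagonalPart ℂ 2) + C z ^ j * pentagonalPart ℂ 1 +
        (C z ^ j) ^ 2 * (pentagonalPart ℂ 3 + pentagonalPart ℂ 4) := by
    intro j _
    have h5 : (z ^ j) ^ 5 = 1 := by rw [← pow_mul, mul_comm, pow_mul, hprim.pow_eq_one, one_pow]
    have h := pentagonalSeries_eq_sum_parts ℂ
    rw [show ∀ a b c d e : ℂ⟦X⟧, a + b + c + d + e = (a + c) + b + (d + e) by intros; ring] at h
    rw [h, map_add, map_add, rescale_of_supportedMod _ h5 (supportedMod_zero_parts ℂ),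
      rescale_of_supportedMod _ h5 (supportedMod_one_part ℂ),
      rescale_of_supportedMod _ h5 (supportedMod_two_parts ℂ)]
    simp
  rw [Finset.prod_congr rfl hj, prod_trinomial_fifth_root _ _ _ _ hC]
  linear_combination (-5 * pentagonalPart ℂ 1 ^ 3 + 5 * pentagonalPart ℂ 1 * (
    (pentagonalPart ℂ 0 + pentagonalPart ℂ 2) * (pentagonalPart ℂ 3 + pentagonalPart ℂ 4) -
      pentagonalPart ℂ 1 ^ 2)) * -parts_mul_eq_neg_sq ℂ

theorem pentagonalPart_norm (R : Type*) [CommRing R] :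
    ((pentagonalPart R 0 + pentagonalPart R 2) ^ 5 + (pentagonalPart R 3 + pentagonalPart R 4) ^ 5
      + 11 * pentagonalPart R 1 ^ 5) * expand 25 (by norm_num) (pentagonalSeries R) =
        expand 5 (by norm_num) (pentagonalSeries R) ^ 6 := by
  have hZ : ((pentagonalPart ℤ 0 + pentagonalPart ℤ 2) ^ 5 +
      (pentagonalPart ℤ 3 + pentagonalPart ℤ 4) ^ 5 + 11 * pentagonalPart ℤ 1 ^ 5) *
        expand 25 (by norm_num) (pentagonalSeries ℤ) =
          expand 5 (by norm_num) (pentagonalSeries ℤ) ^ 6 := by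
    apply map_injective (Int.castRingHom ℂ) Int.cast_injective
    simpa [map_expand, map_pentagonalSeries, map_pentagonalPart,
      map_ofNat (map (Int.castRingHom ℂ)) 11] using pentagonalPart_norm_complex
  simpa [map_expand, map_pentagonalSeries, map_pentagonalPart,
    map_ofNat (map (Int.castRingHom R)) 11] using
    congrArg (map (Int.castRingHom R)) hZ

theorem exists_pentagonalSeries_dissection (R : Type*) [CommRing R] :
    ∃ a b c : R⟦X⟧, pentagonalSeries R = a + b + c ∧ SupportedMod 0 a ∧ SupportedMod 1 b ∧
      SupportedMod 2 c ∧ b = -(X * expand 25 (by norm_num) (pentagonalSeries R)) ∧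
      a * c = -b ^ 2 ∧
      (a ^ 5 + c ^ 5 + 11 * b ^ 5) * expand 25 (by norm_num) (pentagonalSeries R) =
        expand 5 (by norm_num) (pentagonalSeries R) ^ 6 :=
  ⟨_, _, _, by rw [pentagonalSeries_eq_sum_parts]; ring, supportedMod_zero_parts R,
    supportedMod_one_part R, supportedMod_two_parts R, pentagonalPart_one R,
    parts_mul_eq_neg_sq R, pentagonalPart_norm R⟩

section
variable {R : Type*} [CommRing R]

/-- The operator extracting the coefficients at exponents divisible by `5`. -/
noncomputable def extractFive : R⟦X⟧ →ₗ[R] R⟦X⟧ where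
  toFun f := .mk fun n => coeff (5 * n) f
  map_add' f g := by ext; simp
  map_smul' r f := by ext; simp

theorem coeff_extractFive (f : R⟦X⟧) (n : ℕ) : coeff n (extractFive f) = coeff (5 * n) f := by
  simp [extractFive]

theorem extractFive_of_supportedMod {r : ℕ} (hr : r % 5 ≠ 0) {f : R⟦X⟧} (hf : SupportedMod r f) :
    extractFive f = 0 := by
  ext n
  rw [coeff_extractFive, hf _ (by omega), map_zero]

theorem extractFive_expand_mul (f g : R⟦X⟧) :
    extractFive (expand 5 (by norm_num) g * f) = g * extractFive f := by
  ext n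
  rw [coeff_extractFive, coeff_mul, coeff_mul]
  symm
  refine Finset.sum_of_injOn (fun x => (5 * x.1, 5 * x.2)) ?_ ?_ ?_ ?_
  · rintro ⟨a, b⟩ _ ⟨c, d⟩ _ h
    simp only [Prod.mk.injEq] at h ⊢
    omega
  · rintro ⟨a, b⟩ h
    simp only [Finset.mem_coe, Finset.HasAntidiagonal.mem_antidiagonal] at h ⊢
    omega
  · rintro ⟨a, b⟩ h h'
    simp only [Finset.mem_coe, Finset.HasAntidiagonal.mem_antidiagonal, Set.mem_image, Prod.exists,
      Prod.mk.injEq, not_exists] at h h'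
    rw [coeff_expand_of_not_dvd, zero_mul]
    rintro ⟨c, rfl⟩
    exact h' c (n - c) ⟨by omega, by omega, by omega⟩
  · rintro ⟨a, b⟩ _
    rw [coeff_expand_mul, coeff_extractFive]

theorem extractFive_expand (g : R⟦X⟧) : extractFive (expand 5 (by norm_num) g) = g := by
  ext n
  rw [coeff_extractFive, coeff_expand_mul]

theorem SupportedMod.mul {r s : ℕ} {f g : R⟦X⟧} (hf : SupportedMod r f) (hg : SupportedMod s g) :
    SupportedMod (r + s) (f * g) := by
  intro n hn
  rw [coeff_mul]
  refine Finset.sum_eq_zero fun x hx => ?_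
  rw [Finset.HasAntidiagonal.mem_antidiagonal] at hx
  by_cases h1 : x.1 % 5 = r % 5
  · rw [hg x.2 (by omega), mul_zero]
  · rw [hf x.1 h1, zero_mul]

theorem supportedMod_one : SupportedMod 0 (1 : R⟦X⟧) := by
  intro n hn
  rw [coeff_one, if_neg (by rintro rfl; simp at hn)]

theorem SupportedMod.pow {r : ℕ} {f : R⟦X⟧} (hf : SupportedMod r f) (k : ℕ) :
    SupportedMod (k * r) (f ^ k) := by
  induction k with
  | zero => simpa using supportedMod_one
  | succ k ih => rw [pow_succ, add_one_mul]; exact ih.mul hf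

theorem SupportedMod.congr {r s : ℕ} {f : R⟦X⟧} (hf : SupportedMod r f) (h : r % 5 = s % 5) :
    SupportedMod s f := fun n hn => hf n (by rwa [h])

theorem supportedMod_X : SupportedMod 1 (X : R⟦X⟧) := by
  intro n hn
  rw [coeff_X, if_neg (by rintro rfl; simp at hn)]

theorem SupportedMod.zsmul {r : ℕ} {f : R⟦X⟧} (hf : SupportedMod r f) (k : ℤ) :
    SupportedMod r (k • f) := fun n hn => by rw [map_zsmul, hf n hn, smul_zero]

theorem isUnit_pentagonalSeries : IsUnit (pentagonalSeries R) := by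
  rw [isUnit_iff_constantCoeff, ← coeff_zero_eq_constantCoeff_apply]
  have := coeff_pentagonalSeries_pentagonal R 0
  rw [show pentagonal 0 = 0 by rfl] at this
  simp [this]

theorem quintic_of_mul_eq_neg_sq {a b c x : R} (hx : x = a + b + c) (h : a * c = -b ^ 2) :
    x ^ 5 - 5 * b * x ^ 4 + 15 * b ^ 2 * x ^ 3 - 25 * b ^ 3 * x ^ 2 + 25 * b ^ 4 * x
      = a ^ 5 + c ^ 5 + 11 * b ^ 5 := by
  grind

theorem cube_of_quintic (h25 : (25 : R) = 0) {b x m : R}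
    (h : x ^ 5 - 5 * b * x ^ 4 + 15 * b ^ 2 * x ^ 3 - 25 * b ^ 3 * x ^ 2 + 25 * b ^ 4 * x = m) :
    (x ^ 4 - 5 * b * x ^ 3 + 15 * b ^ 2 * x ^ 2) ^ 3 =
      m ^ 2 * (x ^ 2 + 20 * b * x - 10 * b ^ 2) := by
  have h5 : 5 * x ^ 5 = 5 * m := by
    linear_combination 5 * h +
      (b * x ^ 4 - 3 * b ^ 2 * x ^ 3 + 5 * b ^ 3 * x ^ 2 - 5 * b ^ 4 * x) * h25
  have h10 : x ^ 10 = m ^ 2 + 10 * m * (b * x ^ 4 - 3 * b ^ 2 * x ^ 3) := by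
    have hx : x ^ 5 = m + 5 * (b * x ^ 4 - 3 * b ^ 2 * x ^ 3) := by
      linear_combination h + (b ^ 3 * x ^ 2 - b ^ 4 * x) * h25
    linear_combination (x ^ 5 + m + 5 * (b * x ^ 4 - 3 * b ^ 2 * x ^ 3)) * hx +
      (b * x ^ 4 - 3 * b ^ 2 * x ^ 3) ^ 2 * h25
  grind

theorem ninth_of_quintic (h25 : (25 : R) = 0) {b x m : R}
    (h : x ^ 5 - 5 * b * x ^ 4 + 15 * b ^ 2 * x ^ 3 - 25 * b ^ 3 * x ^ 2 + 25 * b ^ 4 * x = m) :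
    x ^ 9 = m * (x ^ 4 + 5 * b * x ^ 3 - 15 * b ^ 2 * x ^ 2) := by
  grind

theorem quadratic_eq_sum {a b c x : R} (hx : x = a + b + c) (h : a * c = -b ^ 2) :
    x ^ 2 + 20 * b * x - 10 * b ^ 2 =
      a ^ 2 + 22 * (a * b) + 9 * b ^ 2 + 22 * (b * c) + c ^ 2 := by
  grind

theorem quartic_eq_sum (h25 : (25 : R) = 0) {a b c x : R} (hx : x = a + b + c)
    (h : a * c = -b ^ 2) :
    x ^ 4 + 5 * b * x ^ 3 - 15 * b ^ 2 * x ^ 2 =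
      (a ^ 4 + 3 * (a * b * c ^ 2) - 35 * (b ^ 3 * c)) +
      (9 * (a ^ 3 * b) + a * c ^ 3 + 3 * (b ^ 2 * c ^ 2)) +
      (3 * (a ^ 2 * b ^ 2) + 9 * (b * c ^ 3) + a ^ 3 * c) +
      (-35 * (a * b ^ 3) + 3 * (a ^ 2 * b * c) + c ^ 4) + 10 * b ^ 4 := by
  grind

theorem extractFive_ofNat_mul (n : ℕ) [n.AtLeastTwo] (f : R⟦X⟧) :
    extractFive (ofNat(n) * f) = ofNat(n) * extractFive f := by
  rw [← Nat.cast_ofNat, ← nsmul_eq_mul, ← nsmul_eq_mul, map_nsmul]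

theorem extractFive_cube (h25 : (25 : R⟦X⟧) = 0) (F : R⟦X⟧)
    (hF : F * pentagonalSeries R = X * expand 5 (by norm_num) (pentagonalSeries R) ^ 5) :
    extractFive (F ^ 3) = 9 * (X * pentagonalSeries R ^ 9 *
      expand 5 (by norm_num) (pentagonalSeries R) ^ 3) := by
  obtain ⟨a, b, c, hx, ha, hb, hc, hbX, hac, hm⟩ := exists_pentagonalSeries_dissection R
  have hu := isUnit_pentagonalSeries (R := R)
  have h55 : expand 25 (by norm_num) (pentagonalSeries R) =
      expand 5 (by norm_num) (expand 5 (by norm_num) (pentagonalSeries R)) :=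
    expand_mul 5 (by norm_num) 5 (by norm_num) _
  have hu5 : IsUnit (expand 5 (by norm_num) (pentagonalSeries R)) := hu.map _
  set x := pentagonalSeries R
  have hX5 : expand 5 (by norm_num) (X : R⟦X⟧) = X ^ 5 := expand_X ..
  have hE : expand 5 (by norm_num) (X * expand 5 (by norm_num) x ^ 3 * x ^ 12) =
    X ^ 5 * expand 25 (by norm_num) x ^ 3 * expand 5 (by norm_num) x ^ 12 := by
    rw [map_mul, map_mul, map_pow, map_pow, hX5, h55]
  set x5 := expand 5 (by norm_num) x with hx5
  set x25 := expand 25 (by norm_num) x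
  set m := a ^ 5 + c ^ 5 + 11 * b ^ 5 with hmdef
  have hsm : SupportedMod 0 m := by
    refine ((ha.pow 5).add ((hc.pow 5).congr (by norm_num))).add ?_
    have := ((hb.pow 5).zsmul 11).congr (s := 0) (by norm_num)
    simpa using this
  have hQ := quintic_of_mul_eq_neg_sq hx hac
  rw [← hmdef] at hQ
  have hP : F * x5 = -b * (x ^ 4 - 5 * b * x ^ 3 + 15 * b ^ 2 * x ^ 2) := by
    refine (hu.mul (hu5.pow 5)).mul_left_cancel ?_
    linear_combination x5 ^ 6 * hF - X * x5 ^ 5 * hm + x5 ^ 5 * m * hbX + x5 ^ 5 * b * hQ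
      + x5 ^ 5 * b * (b ^ 3 * x ^ 2 - b ^ 4 * x) * h25
  have hC : x5 ^ 3 * F ^ 3 = -b ^ 3 * m ^ 2 * a ^ 2 + 22 * (-b ^ 3 * m ^ 2 * (a * b)) +
      9 * (-b ^ 5 * m ^ 2) + 22 * (-b ^ 3 * m ^ 2 * (b * c)) + -b ^ 3 * m ^ 2 * c ^ 2 := by
    linear_combination congrArg (· ^ 3) hP - b ^ 3 * cube_of_quintic h25 hQ
      - b ^ 3 * m ^ 2 * quadratic_eq_sum hx hac
  have hb5 : -b ^ 5 * m ^ 2 = expand 5 (by norm_num) (X * x5 ^ 3 * x ^ 12) := by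
    rw [hE, hbX]
    linear_combination X ^ 5 * x25 ^ 3 * (m * x25 + x5 ^ 6) * hm
  have hbm : SupportedMod 3 (-b ^ 3 * m ^ 2) := by
    have := ((hb.pow 3).mul (hsm.pow 2)).zsmul (-1)
    simpa using this
  have h0 : ∀ {r : ℕ} {f : R⟦X⟧}, SupportedMod r f → (3 + r) % 5 ≠ 0 →
      extractFive (-b ^ 3 * m ^ 2 * f) = 0 := fun hf hr =>
    extractFive_of_supportedMod hr (hbm.mul hf)
  refine (hu.pow 3).mul_left_cancel ?_
  rw [← extractFive_expand_mul, map_pow, ← hx5, hC]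
  simp only [map_add, extractFive_ofNat_mul]
  rw [h0 (ha.pow 2) (by norm_num), h0 (ha.mul hb) (by norm_num), h0 (hb.mul hc) (by norm_num),
    h0 (hc.pow 2) (by norm_num), hb5, extractFive_expand]
  ring

theorem extractFive_X_mul_pow_nine (h25 : (25 : R⟦X⟧) = 0) :
    extractFive (X * pentagonalSeries R ^ 9 * expand 5 (by norm_num) (pentagonalSeries R) ^ 3) =
      10 * (X * pentagonalSeries R ^ 9 *
        expand 5 (by norm_num) (pentagonalSeries R) ^ 3) := by
  obtain ⟨a, b, c, hx, ha, hb, hc, hbX, hac, hm⟩ := exists_pentagonalSeries_dissection R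
  have h55 : expand 25 (by norm_num) (pentagonalSeries R) =
      expand 5 (by norm_num) (expand 5 (by norm_num) (pentagonalSeries R)) :=
    expand_mul 5 (by norm_num) 5 (by norm_num) _
  set x := pentagonalSeries R
  have hX5 : expand 5 (by norm_num) (X : R⟦X⟧) = X ^ 5 := expand_X ..
  have hE : expand 5 (by norm_num) (X * expand 5 (by norm_num) x ^ 3 * x ^ 6) =
    X ^ 5 * expand 25 (by norm_num) x ^ 3 * expand 5 (by norm_num) x ^ 6 := by
    rw [map_mul, map_mul, map_pow, map_pow, hX5, h55]
  set x5 := expand 5 (by norm_num) x with hx5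
  set x25 := expand 25 (by norm_num) x
  set m := a ^ 5 + c ^ 5 + 11 * b ^ 5 with hmdef
  have hsm : SupportedMod 0 m := by
    refine ((ha.pow 5).add ((hc.pow 5).congr (by norm_num))).add ?_
    have := ((hb.pow 5).zsmul 11).congr (s := 0) (by norm_num)
    simpa using this
  have hQ := quintic_of_mul_eq_neg_sq hx hac
  rw [← hmdef] at hQ
  have hb4 : X * m * b ^ 4 = expand 5 (by norm_num) (X * x5 ^ 3 * x ^ 6) := by
    rw [hE, hbX]
    linear_combination X ^ 5 * x25 ^ 3 * hm
  have hXm : SupportedMod 1 (X * m) := supportedMod_X.mul hsm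
  have h0 : ∀ {r : ℕ} {f : R⟦X⟧}, SupportedMod r f → (1 + r) % 5 ≠ 0 →
      extractFive (X * m * f) = 0 := fun hf hr =>
    extractFive_of_supportedMod hr (hXm.mul hf)
  have hC : X * x ^ 9 * x5 ^ 3 = expand 5 (by norm_num) (x ^ 3) * (
      X * m * a ^ 4 + 3 * (X * m * (a * b * c ^ 2)) - 35 * (X * m * (b ^ 3 * c)) +
      9 * (X * m * (a ^ 3 * b)) + X * m * (a * c ^ 3) + 3 * (X * m * (b ^ 2 * c ^ 2)) +
      3 * (X * m * (a ^ 2 * b ^ 2)) + 9 * (X * m * (b * c ^ 3)) + X * m * (a ^ 3 * c) -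
      35 * (X * m * (a * b ^ 3)) + 3 * (X * m * (a ^ 2 * b * c)) + X * m * c ^ 4 +
      10 * (X * m * b ^ 4)) := by
    rw [map_pow, ← hx5]
    linear_combination X * x5 ^ 3 * ninth_of_quintic h25 hQ
      + X * x5 ^ 3 * m * quartic_eq_sum h25 hx hac
  conv_lhs => rw [hC, extractFive_expand_mul]
  simp only [map_add, map_sub, extractFive_ofNat_mul]
  rw [h0 (ha.pow 4) (by norm_num), h0 ((ha.mul hb).mul (hc.pow 2)) (by norm_num),
    h0 ((hb.pow 3).mul hc) (by norm_num), h0 ((ha.pow 3).mul hb) (by norm_num),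
    h0 (ha.mul (hc.pow 3)) (by norm_num), h0 ((hb.pow 2).mul (hc.pow 2)) (by norm_num),
    h0 ((ha.pow 2).mul (hb.pow 2)) (by norm_num), h0 (hb.mul (hc.pow 3)) (by norm_num),
    h0 ((ha.pow 3).mul hc) (by norm_num), h0 (ha.mul (hb.pow 3)) (by norm_num),
    h0 (((ha.pow 2).mul hb).mul hc) (by norm_num), h0 (hc.pow 4) (by norm_num), hb4,
    extractFive_expand]
  ring

/-- If `F` is `X` times the series of `5`-cores, then modulo `25` the coefficients of `F ^ 3` at
multiples of `125` vanish. -/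
theorem coeff_cube_eq_zero (h25 : (25 : R⟦X⟧) = 0) (F : R⟦X⟧)
    (hF : F * pentagonalSeries R = X * expand 5 (by norm_num) (pentagonalSeries R) ^ 5) (n : ℕ) :
    coeff (125 * n) (F ^ 3) = 0 := by
  rw [show 125 * n = 5 * (5 * (5 * n)) by ring, ← coeff_extractFive, ← coeff_extractFive,
    ← coeff_extractFive, extractFive_cube h25 F hF, extractFive_ofNat_mul, extractFive_ofNat_mul,
    extractFive_X_mul_pow_nine h25, extractFive_ofNat_mul, extractFive_X_mul_pow_nine h25]
  rw [← map_zero (coeff (R := R) n)]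
  congr 1
  linear_combination 36 * (X * pentagonalSeries R ^ 9 *
        expand 5 (by norm_num) (pentagonalSeries R) ^ 3) * h25
end

section
variable {R : Type*} [CommRing R]

/-- The inverse of the finite product `∏ i < n, (1 - X ^ (i + 1))`. -/
noncomputable def invEuler (R : Type*) [CommRing R] (n : ℕ) : R⟦X⟧ :=
  invOfUnit (∏ i ∈ Finset.range n, (1 - X ^ (i + 1))) 1

theorem prod_mul_invEuler (n : ℕ) :
    (∏ i ∈ Finset.range n, (1 - (X : R⟦X⟧) ^ (i + 1))) * invEuler R n = 1 :=
  mul_invOfUnit _ _ (by simp [map_prod])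

theorem invEuler_succ_mul (n : ℕ) :
    invEuler R (n + 1) * (1 - X ^ (n + 1)) = invEuler R n := by
  have h0 := prod_mul_invEuler (R := R) n
  have h1 := prod_mul_invEuler (R := R) (n + 1)
  rw [Finset.prod_range_succ] at h1
  linear_combination invEuler R n * h1 - invEuler R (n + 1) * (1 - X ^ (n + 1)) * h0

theorem X_pow_dvd_pentagonalSeries_mul_invEuler_sub_one (n : ℕ) :
    (X : R⟦X⟧) ^ (n + 1) ∣ pentagonalSeries R * invEuler R n - 1 := by
  have h := (X_pow_dvd_pentagonalSeries_sub_prod R n).mul_right (invEuler R n)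
  rwa [sub_mul, prod_mul_invEuler] at h

/-- Euler's generating function of finite subsets of `ℕ`, by cardinality and sum. -/
noncomputable def eulerSeries (R : Type*) [CommRing R] : R⟦X⟧⟦X⟧ :=
  .mk fun n => X ^ n.choose 2 * invEuler R n

theorem eulerSeries_eq_mul_rescale :
    eulerSeries R = (1 + X) * rescale (X : R⟦X⟧) (eulerSeries R) := by
  ext1 n
  cases n with
  | zero => rw [add_mul, map_add, coeff_zero_X_mul, add_zero, one_mul, coeff_rescale]; simp
  | succ n =>
    rw [add_mul, one_mul, map_add, coeff_succ_X_mul, coeff_rescale, coeff_rescale, eulerSeries,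
      coeff_mk, coeff_mk, ← invEuler_succ_mul n, Nat.choose_succ_succ', Nat.choose_one_right]
    ring

theorem eq_of_eq_mul_rescale {f g : R⟦X⟧⟦X⟧} (hf : f = (1 + X) * rescale (X : R⟦X⟧) f)
    (hg : g = (1 + X) * rescale (X : R⟦X⟧) g) (h : coeff 0 f = coeff 0 g) : f = g := by
  have key : ∀ {f : R⟦X⟧⟦X⟧}, f = (1 + X) * rescale (X : R⟦X⟧) f → ∀ n,
      (1 - X ^ (n + 1)) * coeff (n + 1) f = X ^ n * coeff n f := by
    intro f hf n
    have h := congrArg (coeff (n + 1)) hf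
    rw [add_mul, one_mul, map_add, coeff_succ_X_mul, coeff_rescale, coeff_rescale] at h
    linear_combination h
  ext1 n
  induction n with
  | zero => exact h
  | succ n ih =>
    have hu : IsUnit (1 - X ^ (n + 1) : R⟦X⟧) := by
      rw [isUnit_iff_constantCoeff]; simp
    refine hu.mul_left_cancel ?_
    rw [key hf, key hg, ih]

/-- Splitting finite subsets of `ℕ` according to residues modulo `5`. -/
theorem eulerSeries_eq_prod :
    eulerSeries R = ∏ i : Fin 5, rescale ((X : R⟦X⟧) ^ (i : ℕ))
      (map (expand 5 (by norm_num) : R⟦X⟧ →ₐ[R] R⟦X⟧).toRingHom (eulerSeries R)) := by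
  set H := map (expand 5 (by norm_num) : R⟦X⟧ →ₐ[R] R⟦X⟧).toRingHom (eulerSeries R) with hH
  have h5 : H = (1 + X) * rescale (X ^ 5 : R⟦X⟧) H := by
    have h := congrArg (map (expand 5 (by norm_num) : R⟦X⟧ →ₐ[R] R⟦X⟧).toRingHom)
      (eulerSeries_eq_mul_rescale (R := R))
    rw [map_mul, map_add, map_one, map_X, ← rescale_map, ← hH] at h
    convert h using 4
    simp
  refine eq_of_eq_mul_rescale eulerSeries_eq_mul_rescale ?_ ?_
  · rw [map_prod]
    simp only [rescale_rescale, ← pow_succ]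
    simp only [Fin.prod_univ_five, Fin.val_zero, pow_zero, rescale_one, RingHom.id_apply]
    nth_rewrite 1 [h5]
    simp
    ring
  · rw [coeff_zero_eq_constantCoeff_apply, coeff_zero_eq_constantCoeff_apply, map_prod]
    have : ∀ (a : R⟦X⟧) (f : R⟦X⟧⟦X⟧), constantCoeff (rescale a f) = constantCoeff f := by
      intro a f
      rw [← coeff_zero_eq_constantCoeff_apply, coeff_rescale]; simp
    have h1 : constantCoeff (eulerSeries R) = 1 := by
      rw [← coeff_zero_eq_constantCoeff_apply, eulerSeries, coeff_mk]
      simpa using prod_mul_invEuler (R := R) 0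
    have h2 : constantCoeff H = 1 := by
      rw [hH, ← coeff_zero_eq_constantCoeff_apply, coeff_map, coeff_zero_eq_constantCoeff_apply, h1,
        map_one]
    simp [this, h1, h2]

/-- The sum of the elements of the subset of `ℕ` consisting of the `c i` smallest elements of each
residue class `i` modulo `5`. -/
def runnerWeight (c : Fin 5 → ℕ) : ℕ := ∑ i, (i * c i + 5 * (c i).choose 2)

theorem X_pow_choose_mul_invEuler (N : ℕ) :
    X ^ N.choose 2 * invEuler R N = ∑ c ∈ Finset.piAntidiag Finset.univ N,
      X ^ runnerWeight c * ∏ i : Fin 5, expand 5 (by norm_num) (invEuler R (c i)) := by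
  have h := congrArg (coeff N) (eulerSeries_eq_prod (R := R))
  rw [eulerSeries, coeff_mk, coeff_prod] at h
  rw [h]
  refine Finset.sum_nbij (fun c i => c i) ?_ ?_ ?_ ?_
  · intro c hc
    simpa using hc
  · intro c _ d _ h
    exact DFunLike.coe_injective h
  · intro c hc
    refine ⟨Finsupp.equivFunOnFinite.symm c, ?_, rfl⟩
    simpa using hc
  · intro c _
    rw [runnerWeight, ← Finset.prod_pow_eq_pow_sum, ← Finset.prod_mul_distrib]
    refine Finset.prod_congr rfl fun i _ => ?_
    rw [coeff_rescale, coeff_map, coeff_mk]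
    simp only [AlgHom.toRingHom_eq_coe, RingHom.coe_coe, map_mul, map_pow, expand_X]
    ring

theorem sq_le_two_mul_runnerWeight {M : ℕ} {c : Fin 5 → ℕ} (hc : ∑ i, c i = 5 * M) (i : Fin 5) :
    ((c i : ℤ) - M) ^ 2 + 2 * (5 * M).choose 2 ≤ 2 * runnerWeight c := by
  have hch : ∀ n : ℕ, 2 * (n.choose 2 : ℤ) = n * (n - 1) := by
    intro n
    induction n with
    | zero => simp
    | succ n ih =>
      rw [Nat.choose_succ_succ', Nat.choose_one_right]
      push_cast
      linear_combination ih
  have hlin : ∀ n k : ℤ, |k| ≤ 2 → 0 ≤ 4 * n ^ 2 + 2 * k * n := by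
    intro n k hk
    have : |k * n| ≤ 2 * n ^ 2 := by
      rw [abs_mul, ← sq_abs n]
      nlinarith [abs_nonneg n, Int.le_self_sq |n|]
    linarith [neg_abs_le (k * n)]
  have hw : (2 : ℤ) * runnerWeight c = 2 * (5 * M).choose 2 +
      ∑ j : Fin 5, (5 * ((c j : ℤ) - M) ^ 2 + 2 * ((j : ℤ) - 2) * (c j - M)) := by
    have h1 : (2 : ℤ) * runnerWeight c =
        ∑ j : Fin 5, (2 * (j : ℤ) * c j + 5 * (c j * ((c j : ℤ) - 1))) := by
      rw [runnerWeight]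
      push_cast
      rw [Finset.mul_sum]
      refine Finset.sum_congr rfl fun j _ => ?_
      linear_combination 5 * hch (c j)
    have h2 : ∑ i, (c i : ℤ) = 5 * M := by exact_mod_cast hc
    rw [h1, hch]
    simp only [Fin.sum_univ_five] at h2 ⊢
    push_cast
    simp
    linear_combination (10 * (M : ℤ) - 1) * h2
  rw [hw, add_comm, add_le_add_iff_left]
  have hterm : ∀ j : Fin 5, ((c j : ℤ) - M) ^ 2 ≤
      5 * ((c j : ℤ) - M) ^ 2 + 2 * ((j : ℤ) - 2) * (c j - M) := by
    intro j
    have hj : |(j : ℤ) - 2| ≤ 2 := by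
      have := j.isLt
      rw [abs_le]; omega
    linarith [hlin ((c j : ℤ) - M) (j - 2) hj]
  exact (hterm i).trans (Finset.single_le_sum
    (f := fun j : Fin 5 => 5 * ((c j : ℤ) - M) ^ 2 + 2 * ((j : ℤ) - 2) * (c j - M))
    (fun j _ => (sq_nonneg _).trans (hterm j)) (Finset.mem_univ i))

theorem choose_le_runnerWeight {M : ℕ} {c : Fin 5 → ℕ} (hc : ∑ i, c i = 5 * M) :
    (5 * M).choose 2 ≤ runnerWeight c := by
  have := sq_le_two_mul_runnerWeight hc 0
  have h2 := sq_nonneg ((c 0 : ℤ) - M)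
  omega

theorem le_of_runnerWeight_lt {L : ℕ} {c : Fin 5 → ℕ} (hc : ∑ i, c i = 5 * (3 * L))
    (h : runnerWeight c < (5 * (3 * L)).choose 2 + L) (i : Fin 5) : L ≤ c i := by
  have h1 := sq_le_two_mul_runnerWeight hc i
  by_contra! h2
  have h3 : (2 * L : ℤ) ≤ ((3 * L : ℕ) : ℤ) - c i := by push_cast; omega
  have h4 : (2 * L : ℤ) ≤ (c i - ((3 * L : ℕ) : ℤ)) ^ 2 := by
    nlinarith [Int.le_self_sq (((3 * L : ℕ) : ℤ) - c i)]
  omega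

theorem X_pow_dvd_prod_sub_one {ι : Type*} (s : Finset ι) (f : ι → R⟦X⟧) (L : ℕ)
    (h : ∀ i ∈ s, X ^ L ∣ f i - 1) : X ^ L ∣ ∏ i ∈ s, f i - 1 := by
  classical
  induction s using Finset.induction_on with
  | empty => simp
  | insert a s ha ih =>
    rw [Finset.prod_insert ha]
    have h1 := (h a (by simp)).mul_right (∏ i ∈ s, f i)
    have h2 := ih fun i hi => h i (by simp [hi])
    rw [show f a * ∏ i ∈ s, f i - 1 = (f a - 1) * ∏ i ∈ s, f i + (∏ i ∈ s, f i - 1) by ring]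
    exact dvd_add h1 h2

/-- The generating function of `5`-cores, in terms of their counts by runner lengths. -/
theorem mk_mul_pentagonalSeries (κ : ℕ → ℕ) (hκ : ∀ m M, m ≤ 5 * M →
      κ m = ((Finset.piAntidiag (Finset.univ : Finset (Fin 5)) (5 * M)).filter
        fun c => runnerWeight c = m + (5 * M).choose 2).card) :
    (mk fun m => (κ m : R)) * pentagonalSeries R =
      expand 5 (by norm_num) (pentagonalSeries R) ^ 5 := by
  set E := pentagonalSeries R
  set E5 := expand 5 (by norm_num) E with hE5
  ext n
  set L := n + 1 with hL
  set N := 5 * (3 * L) with hN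
  set T := Finset.piAntidiag (Finset.univ : Finset (Fin 5)) N with hT
  have hmem : ∀ c ∈ T, ∑ i, c i = N := fun c hc => by simpa [hT] using hc
  have hdvd : ∀ k (f : R⟦X⟧), N.choose 2 + L ≤ k → X ^ (N.choose 2 + L) ∣ X ^ k * f :=
    fun k f hk => (pow_dvd_pow _ hk).mul_right _
  have h1 : X ^ (N.choose 2 + L) ∣
      X ^ N.choose 2 * (mk fun m => (κ m : R)) - ∑ c ∈ T, X ^ runnerWeight c := by
    rw [X_pow_dvd_iff]
    intro k hk
    rw [map_sub, coeff_X_pow_mul', map_sum]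
    simp only [coeff_X_pow]
    rw [Finset.sum_boole, sub_eq_zero]
    split_ifs with h
    · rw [coeff_mk, hκ (k - N.choose 2) (3 * L) (by omega)]
      congr 3 with c
      rw [← hN]
      omega
    · rw [Finset.filter_eq_empty_iff.2, Finset.card_empty, Nat.cast_zero]
      rintro c hc rfl
      exact h (choose_le_runnerWeight (hmem c hc))
  have h2 : X ^ (N.choose 2 + L) ∣
      X ^ N.choose 2 * invEuler R N * E5 ^ 5 - ∑ c ∈ T, X ^ runnerWeight c := by
    rw [X_pow_choose_mul_invEuler, Finset.sum_mul, ← Finset.sum_sub_distrib]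
    refine Finset.dvd_sum fun c hc => ?_
    rw [show X ^ runnerWeight c * (∏ i : Fin 5, expand 5 (by norm_num) (invEuler R (c i))) * E5 ^ 5
      - X ^ runnerWeight c = X ^ runnerWeight c *
        (∏ i : Fin 5, expand 5 (by norm_num) (E * invEuler R (c i)) - 1) by
      simp only [map_mul, Finset.prod_mul_distrib, Finset.prod_const, Finset.card_univ,
        Fintype.card_fin, ← hE5]
      ring]
    by_cases hw : N.choose 2 + L ≤ runnerWeight c
    · exact hdvd _ _ hw
    · rw [pow_add]
      refine mul_dvd_mul (pow_dvd_pow _ (choose_le_runnerWeight (hmem c hc))) ?_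
      refine X_pow_dvd_prod_sub_one _ _ _ fun i _ => ?_
      have hi := le_of_runnerWeight_lt (hmem c hc) (not_le.1 hw) i
      have h3 := map_dvd (expand 5 (by norm_num) : R⟦X⟧ →ₐ[R] R⟦X⟧)
        (X_pow_dvd_pentagonalSeries_mul_invEuler_sub_one (R := R) (c i))
      rw [map_sub, map_one, map_pow, expand_X, ← pow_mul] at h3
      exact (pow_dvd_pow _ (by omega)).trans h3
  have h3 : X ^ (N.choose 2 + L) ∣ X ^ N.choose 2 * E5 ^ 5 * (E * invEuler R N - 1) := by
    rw [pow_add]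
    refine mul_dvd_mul (Dvd.intro _ rfl) ((pow_dvd_pow _ ?_).trans
      (X_pow_dvd_pentagonalSeries_mul_invEuler_sub_one N))
    omega
  have h4 : X ^ (N.choose 2 + L) ∣
      X ^ N.choose 2 * ((mk fun m => (κ m : R)) * E - E5 ^ 5) := by
    have := (dvd_add (dvd_sub (h1.mul_left E) (h2.mul_left E)) h3)
    convert this using 1
    ring
  rw [X_pow_dvd_iff] at h4
  have h5 := h4 (n + N.choose 2) (by omega)
  rwa [coeff_X_pow_mul, map_sub, sub_eq_zero] at h5
end

end

section

theorem lt_getD_iff_of_sortedGE {l : List ℕ} (hl : l.Pairwise (· ≥ ·)) (i j : ℕ) :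
    j < l.getD i 0 ↔ i < (l.filter (j < ·)).length := by
  induction l generalizing i with
  | nil => simp
  | cons a l ih =>
    rw [List.pairwise_cons] at hl
    by_cases h : j < a
    · cases i with
      | zero => simp [h]
      | succ i => simpa [h] using ih hl.2 i
    · have h1 : l.filter (j < ·) = [] := by
        rw [List.filter_eq_nil_iff]
        intro b hb
        have := hl.1 b hb
        simp; omega
      have h2 := ih hl.2
      rw [h1] at h2
      cases i with
      | zero => simp [h, h1]
      | succ i => simpa [h, h1] using h2 i

theorem sum_range_getD {l : List ℕ} {N : ℕ} (h : l.length ≤ N) :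
    ∑ i ∈ Finset.range N, l.getD i 0 = l.sum := by
  induction l generalizing N with
  | nil => simp
  | cons a l ih =>
    obtain ⟨N, rfl⟩ : ∃ k, N = k + 1 := ⟨N - 1, by simp at h; omega⟩
    rw [Finset.sum_range_succ', List.sum_cons, ← ih (N := N) (by simpa using h), add_comm]
    simp

namespace Nat.Partition
variable {m : ℕ}

/-- The length of the `i`-th row of the Ferrers–Young diagram. -/
def rowLen (p : m.Partition) (i : ℕ) : ℕ := (p.parts.sort (· ≤ ·)).reverse.getD i 0

/-- The length of the `j`-th column of the Ferrers–Young diagram. -/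
def colLen (p : m.Partition) (j : ℕ) : ℕ := (p.parts.filter (fun x => j < x)).card

theorem lt_rowLen_iff (p : m.Partition) {i j : ℕ} : j < p.rowLen i ↔ i < p.colLen j := by
  rw [rowLen, lt_getD_iff_of_sortedGE]
  · conv_rhs => rw [colLen, ← p.parts.sort_eq (· ≤ ·), Multiset.filter_coe, Multiset.coe_card]
    rw [List.filter_reverse, List.length_reverse]
  · rw [List.pairwise_reverse]
    exact p.parts.pairwise_sort (· ≤ ·)

theorem rowLen_antitone (p : m.Partition) : Antitone p.rowLen := by
  intro i k hik
  refine le_of_forall_lt fun j hj => ?_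
  rw [lt_rowLen_iff] at hj ⊢
  omega

theorem card_parts_le (p : m.Partition) : p.parts.card ≤ m := by
  have := Multiset.card_nsmul_le_sum (s := p.parts) (a := 1) fun x hx => p.parts_pos hx
  simpa [p.parts_sum] using this

theorem colLen_le (p : m.Partition) (j : ℕ) : p.colLen j ≤ m :=
  (Multiset.card_le_card (Multiset.filter_le _ _)).trans p.card_parts_le

theorem rowLen_eq_zero (p : m.Partition) {i : ℕ} (h : m ≤ i) : p.rowLen i = 0 := by
  by_contra h0
  have := p.lt_rowLen_iff.1 (Nat.pos_of_ne_zero h0)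
  have := p.colLen_le 0
  omega

theorem sum_range_rowLen (p : m.Partition) {N : ℕ} (h : m ≤ N) :
    ∑ i ∈ Finset.range N, p.rowLen i = m := by
  unfold rowLen
  rw [sum_range_getD (by simpa using p.card_parts_le.trans h), List.sum_reverse,
    ← Multiset.sum_coe, Multiset.sort_eq, p.parts_sum]

theorem rowLen_injective : Function.Injective (rowLen : m.Partition → ℕ → ℕ) := by
  intro p q h
  have hcol : ∀ j, p.colLen j = q.colLen j := by
    intro j
    refine eq_of_forall_lt_iff fun i => ?_
    rw [← lt_rowLen_iff, ← lt_rowLen_iff, h]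
  have hcount : ∀ (r : m.Partition) (k : ℕ),
      r.parts.count (k + 1) + r.colLen (k + 1) = r.colLen k := by
    intro r k
    rw [colLen, colLen]
    induction r.parts using Multiset.induction_on with
    | empty => simp
    | cons a s ih =>
      rw [Multiset.count_cons, Multiset.filter_cons, Multiset.filter_cons, Multiset.card_add,
        Multiset.card_add]
      split_ifs <;> simp <;> omega
  ext k
  cases k with
  | zero =>
    rw [Multiset.count_eq_zero_of_notMem fun h => (p.parts_pos h).ne' rfl,
      Multiset.count_eq_zero_of_notMem fun h => (q.parts_pos h).ne' rfl]
  | succ k =>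
    have h1 := hcount p k
    have h2 := hcount q k
    rw [hcol, hcol] at h1
    omega

theorem exists_rowLen_eq {f : ℕ → ℕ} {N : ℕ} (hf : AntitoneOn f (Set.Iio N))
    (hsum : ∑ i ∈ Finset.range N, f i = m) :
    ∃ p : m.Partition, ∀ i < N, p.rowLen i = f i := by
  refine ⟨.ofSums m ((Multiset.range N).map f) hsum, fun i hi => ?_⟩
  refine eq_of_forall_lt_iff fun j => ?_
  have h0 : (ofSums m ((Multiset.range N).map f) hsum).parts =
      ((Multiset.range N).map f).filter (· ≠ 0) := rfl
  rw [lt_rowLen_iff, colLen, h0, Multiset.filter_filter]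
  have h1 : ((Multiset.range N).map f).filter (fun a => j < a ∧ a ≠ 0) =
      ((Multiset.range N).filter fun i => j < f i).map f := by
    rw [Multiset.filter_map]
    congr 1
    refine Multiset.filter_congr fun x _ => ?_
    simp only [Function.comp]
    omega
  rw [h1, Multiset.card_map]
  change i < ((Finset.range N).filter fun i => j < f i).card ↔ _
  constructor
  · intro h
    by_contra h2
    have : (Finset.range N).filter (fun i => j < f i) ⊆ Finset.range i := by
      intro k hk
      simp only [Finset.mem_filter, Finset.mem_range] at hk ⊢
      by_contra! hik
      have := hf (Set.mem_Iio.2 hi) (Set.mem_Iio.2 hk.1) hik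
      omega
    have := Finset.card_le_card this
    rw [Finset.card_range] at this
    omega
  · intro h
    have : Finset.range (i + 1) ⊆ (Finset.range N).filter (fun i => j < f i) := by
      intro k hk
      simp only [Finset.mem_filter, Finset.mem_range] at hk ⊢
      have := hf (Set.mem_Iio.2 (by omega)) (Set.mem_Iio.2 hi) (Nat.lt_succ_iff.1 hk)
      omega
    have := Finset.card_le_card this
    rw [Finset.card_range] at this
    omega

theorem hookLength_eq (p : m.Partition) (i j : ℕ) :
    hookLength p i j = (p.rowLen i - j) + (p.colLen j - i) - 1 := rfl

/-- The set of first-column hook lengths of the partition padded to `N` rows. -/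
def betaSet (p : m.Partition) (N : ℕ) : Finset ℕ :=
  (Finset.range N).image fun i => p.rowLen i + (N - 1 - i)

theorem mem_betaSet {p : m.Partition} {N x : ℕ} :
    x ∈ p.betaSet N ↔ ∃ i < N, p.rowLen i + (N - 1 - i) = x := by
  simp [betaSet]

theorem beta_injOn (p : m.Partition) (N : ℕ) :
    Set.InjOn (fun i => p.rowLen i + (N - 1 - i)) (Finset.range N) := by
  intro i hi k hk h
  simp only [Finset.coe_range, Set.mem_Iio] at hi hk h
  rcases le_total i k with hik | hik <;> have := p.rowLen_antitone hik <;> omega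

theorem card_betaSet (p : m.Partition) (N : ℕ) : (p.betaSet N).card = N := by
  rw [betaSet, Finset.card_image_of_injOn (p.beta_injOn N), Finset.card_range]

theorem sum_betaSet (p : m.Partition) {N : ℕ} (h : m ≤ N) :
    ∑ x ∈ p.betaSet N, x = m + N.choose 2 := by
  rw [betaSet, Finset.sum_image (p.beta_injOn N), Finset.sum_add_distrib, p.sum_range_rowLen h,
    Finset.sum_range_reflect (fun i => i), Finset.sum_range_id, Nat.choose_two_right]

end Nat.Partition

/-- A set of beads on the `t`-runner abacus is flush if every bead is as high as possible. -/
def IsFlush (t : ℕ) (S : Finset ℕ) : Prop := ∀ x ∈ S, t ≤ x → x - t ∈ S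

theorem IsFlush.sub_mul_mem {t : ℕ} {S : Finset ℕ} (hS : IsFlush t S) {x : ℕ} (hx : x ∈ S) (k : ℕ)
    (h : t * k ≤ x) : x - t * k ∈ S := by
  induction k with
  | zero => simpa using hx
  | succ k ih =>
    rw [mul_add_one] at h ⊢
    rw [← Nat.sub_sub]
    exact hS _ (ih (by omega)) (by omega)

namespace Nat.Partition
variable {m : ℕ}

theorem isTCore_iff_isFlush (p : m.Partition) {t N : ℕ} (ht : 0 < t) (h : m ≤ N) :
    IsTCore t p ↔ IsFlush t (p.betaSet N) := by
  constructor
  · intro hp x hx htx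
    obtain ⟨i, hi, rfl⟩ := mem_betaSet.1 hx
    by_contra hy
    set y := p.rowLen i + (N - 1 - i) - t with hydef
    have hne : ∀ k < N, p.rowLen k + (N - 1 - k) ≠ y := fun k hk h => hy (mem_betaSet.2 ⟨k, hk, h⟩)
    have hex : ∃ r, N ≤ r ∨ p.rowLen r + (N - 1 - r) < y := ⟨N, .inl le_rfl⟩
    obtain ⟨r, hr, hmin⟩ : ∃ r, (N ≤ r ∨ p.rowLen r + (N - 1 - r) < y) ∧
        ∀ k < r, ¬ (N ≤ k ∨ p.rowLen k + (N - 1 - k) < y) := by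
      classical
      exact ⟨Nat.find hex, Nat.find_spec hex, fun k hk => Nat.find_min hex hk⟩
    have hrN : r ≤ N := by
      by_contra! hlt
      exact hmin N hlt (.inl le_rfl)
    have hir : i < r := by
      by_contra! hri
      have := p.rowLen_antitone hri
      omega
    have hz := p.rowLen_eq_zero h
    have hcol : p.colLen (y + r - N) = r := by
      refine le_antisymm ?_ ?_
      · by_contra! hlt
        rw [← lt_rowLen_iff] at hlt
        rcases hr with hr | hr
        · obtain rfl : r = N := by omega
          omega
        · omega
      · have h1 := hmin (r - 1) (by omega)
        have h2 := hne (r - 1) (by omega)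
        have : r - 1 < p.colLen (y + r - N) := by
          rw [← lt_rowLen_iff]
          omega
        omega
    have hlt : y + r - N < p.rowLen i := by
      rw [lt_rowLen_iff, hcol]; exact hir
    refine hp i (y + r - N) hlt ?_
    rw [hookLength_eq, hcol]
    have : p.rowLen i - (y + r - N) + (r - i) - 1 = t := by
      rcases hr with hr | hr
      · omega
      · omega
    rw [this]
  · rintro hS i j hij ⟨k, hk⟩
    have hi := p.lt_rowLen_iff.1 hij
    have hjN := p.colLen_le j
    rw [hookLength_eq] at hk
    change j < p.rowLen i at hij
    have hx : p.rowLen i + (N - 1 - i) ∈ p.betaSet N := mem_betaSet.2 ⟨i, by omega, rfl⟩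
    obtain ⟨l, hl, hl'⟩ := mem_betaSet.1 (hS.sub_mul_mem hx k (by omega))
    rcases lt_or_ge l (p.colLen j) with hlj | hlj
    · have := p.lt_rowLen_iff.2 hlj
      omega
    · have : p.rowLen l ≤ j := by
        by_contra! hlt
        have := p.lt_rowLen_iff.1 hlt
        omega
      omega

end Nat.Partition

end

section
namespace Nat.Partition
variable {m : ℕ}

theorem betaSet_injective {N : ℕ} (h : m ≤ N) :
    Function.Injective fun p : m.Partition => p.betaSet N := by
  intro p q hpq
  have hle : ∀ {p q : m.Partition}, p.betaSet N = q.betaSet N → ∀ i < N,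
      (∀ k < i, p.rowLen k = q.rowLen k) → p.rowLen i ≤ q.rowLen i := by
    intro p q hpq i hi hlt
    obtain ⟨k, hk, hk'⟩ := mem_betaSet.1 (hpq ▸ mem_betaSet.2 ⟨i, hi, rfl⟩)
    rcases lt_or_ge k i with hki | hki
    · have := hlt k hki
      have := p.rowLen_antitone hki.le
      omega
    · have := q.rowLen_antitone hki
      omega
  refine rowLen_injective (funext fun i => ?_)
  induction i using Nat.strong_induction_on with
  | _ i ih =>
    rcases lt_or_ge i N with hi | hi
    · exact le_antisymm (hle hpq i hi ih) (hle hpq.symm i hi fun k hk => (ih k hk).symm)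
    · rw [rowLen_eq_zero _ (h.trans hi), rowLen_eq_zero _ (h.trans hi)]

theorem exists_betaSet_eq {N : ℕ} {S : Finset ℕ} (hcard : S.card = N)
    (hsum : ∑ x ∈ S, x = m + N.choose 2) : ∃ p : m.Partition, p.betaSet N = S := by
  have hfin : {x | x ∈ S}.Finite := S.finite_toSet
  have hF : hfin.toFinset = S := by ext; simp
  set s := Nat.nth (· ∈ S) with hs
  have hmono : StrictMonoOn s (Set.Iio N) := by
    have := Nat.nth_strictMonoOn (p := (· ∈ S)) hfin
    rwa [hF, hcard] at this
  have himage : (Finset.range N).image s = S := by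
    have := Nat.image_nth_Iio_card (p := (· ∈ S)) hfin
    rw [hF, hcard] at this
    rw [← Finset.coe_inj, Finset.coe_image, Finset.coe_range, this]
    rfl
  have hle : ∀ i k, i ≤ k → k < N → s i + (k - i) ≤ s k := by
    intro i k hik hk
    induction k, hik using Nat.le_induction with
    | base => simp
    | succ k hik ih =>
      have := hmono (Set.mem_Iio.2 (by omega : k < N)) (Set.mem_Iio.2 hk) (by omega)
      have := ih (by omega)
      omega
  have hid : ∀ k < N, k ≤ s k := fun k hk => by
    have := hle 0 k (by omega) hk
    omega
  have hsums : ∑ i ∈ Finset.range N, s i = m + N.choose 2 := by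
    rw [← hsum, ← himage, Finset.sum_image fun i hi k hk h => hmono.injOn (by simpa using hi)
      (by simpa using hk) h]
  obtain ⟨p, hp⟩ := exists_rowLen_eq (m := m) (f := fun i => s (N - 1 - i) - (N - 1 - i)) (N := N)
    (by
      intro i hi k hk hik
      have := hle (N - 1 - k) (N - 1 - i) (by omega) (by simp at hi; omega)
      simp only
      omega)
    (by
      rw [Finset.sum_range_reflect (fun i => s i - i), ← Nat.add_right_cancel_iff (n := N.choose 2),
        ← hsums, Nat.choose_two_right, ← Finset.sum_range_id, ← Finset.sum_add_distrib]
      refine Finset.sum_congr rfl fun i hi => ?_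
      have := hid i (Finset.mem_range.1 hi)
      omega)
  refine ⟨p, ?_⟩
  ext x
  rw [mem_betaSet, ← himage]
  simp only [Finset.mem_image, Finset.mem_range]
  constructor
  · rintro ⟨i, hi, rfl⟩
    refine ⟨N - 1 - i, by omega, ?_⟩
    have := hid (N - 1 - i) (by omega)
    rw [hp i hi]
    omega
  · rintro ⟨i, hi, rfl⟩
    refine ⟨N - 1 - i, by omega, ?_⟩
    rw [hp _ (by omega), show N - 1 - (N - 1 - i) = i by omega]
    have := hid i hi
    omega

end Nat.Partition

/-- The flush set of beads with `c i` beads on runner `i`. -/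
def runnerSet (c : Fin 5 → ℕ) : Finset ℕ :=
  (Finset.univ.sigma fun i => Finset.range (c i)).image fun x => 5 * x.2 + x.1

theorem runnerSet_injOn (c : Fin 5 → ℕ) :
    Set.InjOn (fun x : (_ : Fin 5) × ℕ => 5 * x.2 + x.1)
      (Finset.univ.sigma fun i => Finset.range (c i)) := by
  rintro ⟨i, j⟩ _ ⟨k, l⟩ _ h
  simp only at h
  have h1 := i.isLt
  have h2 := k.isLt
  obtain rfl : j = l := by omega
  obtain rfl : i = k := by ext; omega
  rfl

theorem mem_runnerSet {c : Fin 5 → ℕ} (i : Fin 5) (j : ℕ) :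
    5 * j + i ∈ runnerSet c ↔ j < c i := by
  simp only [runnerSet, Finset.mem_image, Finset.mem_sigma, Finset.mem_univ, true_and,
    Finset.mem_range, Sigma.exists]
  constructor
  · rintro ⟨k, l, hl, h⟩
    have h1 := i.isLt
    have h2 := k.isLt
    obtain rfl : j = l := by omega
    obtain rfl : i = k := by ext; omega
    exact hl
  · intro h
    exact ⟨i, j, h, rfl⟩

theorem card_runnerSet (c : Fin 5 → ℕ) : (runnerSet c).card = ∑ i, c i := by
  rw [runnerSet, Finset.card_image_of_injOn (runnerSet_injOn c), Finset.card_sigma]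
  simp

theorem sum_runnerSet (c : Fin 5 → ℕ) : ∑ x ∈ runnerSet c, x = runnerWeight c := by
  rw [runnerSet, Finset.sum_image (runnerSet_injOn c), Finset.sum_sigma, runnerWeight]
  refine Finset.sum_congr rfl fun i _ => ?_
  simp only
  rw [Finset.sum_add_distrib, ← Finset.mul_sum, Finset.sum_range_id, ← Nat.choose_two_right,
    Finset.sum_const, Finset.card_range, smul_eq_mul]
  ring

theorem exists_fin_five (x : ℕ) : ∃ (i : Fin 5) (j : ℕ), x = 5 * j + i :=
  ⟨⟨x % 5, by omega⟩, x / 5, by simp only; omega⟩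

theorem isFlush_runnerSet (c : Fin 5 → ℕ) : IsFlush 5 (runnerSet c) := by
  intro x hx h5
  obtain ⟨i, j, rfl⟩ := exists_fin_five x
  have hi := i.isLt
  rw [mem_runnerSet] at hx
  rw [show 5 * j + i - 5 = 5 * (j - 1) + (i : ℕ) by omega, mem_runnerSet]
  omega

theorem runnerSet_injective : Function.Injective runnerSet := by
  intro c d h
  ext i
  refine eq_of_forall_lt_iff fun j => ?_
  rw [← mem_runnerSet, ← mem_runnerSet, h]

theorem IsFlush.exists_runnerSet_eq {S : Finset ℕ} (hS : IsFlush 5 S) :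
    ∃ c, runnerSet c = S := by
  have hex : ∀ i : Fin 5, ∃ c : ℕ, ∀ j : ℕ, 5 * j + (i : ℕ) ∈ S ↔ j < c := by
    intro i
    have hne : ∃ j, 5 * j + (i : ℕ) ∉ S := by
      obtain ⟨b, hb⟩ := S.bddAbove
      refine ⟨b + 1, fun h => ?_⟩
      have := hb h
      omega
    classical
    refine ⟨Nat.find hne, fun j => ⟨fun hj => ?_, fun hj => not_not.1 (Nat.find_min hne hj)⟩⟩
    by_contra! hle
    refine Nat.find_spec hne ?_
    have := hS.sub_mul_mem hj (j - Nat.find hne) (by omega)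
    rwa [show 5 * j + i - 5 * (j - Nat.find hne) = 5 * Nat.find hne + (i : ℕ) by omega] at this
  choose c hc using hex
  refine ⟨c, ?_⟩
  ext x
  obtain ⟨i, j, rfl⟩ := exists_fin_five x
  rw [mem_runnerSet, hc]

theorem card_isTCore_five {m M : ℕ} (h : m ≤ 5 * M) :
    Nat.card {p : m.Partition // IsTCore 5 p} =
      ((Finset.piAntidiag (Finset.univ : Finset (Fin 5)) (5 * M)).filter
        fun c => runnerWeight c = m + (5 * M).choose 2).card := by
  rw [← Nat.card_eq_finsetCard]
  have hcore : ∀ p : m.Partition, IsTCore 5 p ↔ IsFlush 5 (p.betaSet (5 * M)) := fun p =>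
    p.isTCore_iff_isFlush (by norm_num) h
  symm
  have key : ∀ c : {c // c ∈ (Finset.piAntidiag (Finset.univ : Finset (Fin 5)) (5 * M)).filter
      fun c => runnerWeight c = m + (5 * M).choose 2},
      ∃ p : {p : m.Partition // IsTCore 5 p}, p.1.betaSet (5 * M) = runnerSet c := by
    rintro ⟨c, hc⟩
    simp only [Finset.mem_filter, Finset.mem_piAntidiag, Finset.mem_univ, implies_true,
      and_true] at hc
    obtain ⟨p, hp⟩ := Nat.Partition.exists_betaSet_eq (m := m) (N := 5 * M)
      ((card_runnerSet c).trans hc.1) ((sum_runnerSet c).trans hc.2)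
    exact ⟨⟨p, (hcore p).2 (hp ▸ isFlush_runnerSet c)⟩, hp⟩
  choose f hf using key
  refine Nat.card_congr (Equiv.ofBijective f ⟨fun c d hcd => ?_, fun p => ?_⟩)
  · exact Subtype.ext (runnerSet_injective ((hf c).symm.trans (hcd ▸ hf d)))
  · obtain ⟨c, hc⟩ := ((hcore p.1).1 p.2).exists_runnerSet_eq
    refine ⟨⟨c, ?_⟩, Subtype.ext (Nat.Partition.betaSet_injective h ((hf _).trans hc))⟩
    simp only [Finset.mem_filter, Finset.mem_piAntidiag, Finset.mem_univ, implies_true, and_true]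
    rw [← card_runnerSet, ← sum_runnerSet, hc, p.1.card_betaSet, p.1.sum_betaSet h]
    exact ⟨rfl, rfl⟩
end

section
open PowerSeries

theorem numA_eq_coeff (t k n : ℕ) :
    (numA t k n : ℤ) =
      coeff n ((mk fun m => (Nat.card {p : m.Partition // IsTCore t p} : ℤ)) ^ k) := by
  classical
  set κ : ℕ → ℕ := fun m => Nat.card {p : m.Partition // IsTCore t p} with hκ
  set A : ℕ → Finset (Σ m : Fin (n + 1), Nat.Partition (m : ℕ)) := fun j =>
    Finset.univ.filter fun x => (x.1 : ℕ) = j ∧ IsTCore t x.2 with hA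
  have hcard : ∀ j ≤ n, (A j).card = κ j := by
    intro j hj
    rw [hκ, ← Nat.card_eq_finsetCard]
    symm
    refine Nat.card_congr (Equiv.ofBijective (fun p => ⟨⟨⟨j, by omega⟩, p.1⟩, ?_⟩) ⟨?_, ?_⟩)
    · simpa [hA] using p.2
    · intro p q h
      simpa [Subtype.ext_iff] using h
    · rintro ⟨⟨⟨i, hi⟩, p⟩, hp⟩
      obtain ⟨rfl, hp'⟩ : i = j ∧ IsTCore t p := by simpa [hA] using hp
      exact ⟨⟨p, hp'⟩, rfl⟩
  have h1 : numA t k n = ∑ c ∈ Finset.piAntidiag (Finset.univ : Finset (Fin k)) n,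
      ∏ i, κ (c i) := by
    rw [numA, Nat.subtype_card (Finset.univ.filter fun f : Fin k → Σ m : Fin (n + 1),
      Nat.Partition (m : ℕ) => (∑ i, ((f i).1 : ℕ)) = n ∧ ∀ i, IsTCore t (f i).2) (by simp),
      Finset.card_eq_sum_card_fiberwise (f := fun f i => ((f i).1 : ℕ))
        (t := Finset.piAntidiag Finset.univ n) (fun f hf => by simpa using (Finset.mem_filter.1 hf).2.1)]
    refine Finset.sum_congr rfl fun c hc => ?_
    have hc : ∑ i, c i = n := by simpa using hc
    have hcn : ∀ i, c i ≤ n := fun i =>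
      hc ▸ Finset.single_le_sum (fun _ _ => Nat.zero_le _) (Finset.mem_univ i)
    rw [← Finset.prod_congr rfl fun i _ => hcard (c i) (hcn i), ← Fintype.card_piFinset]
    congr 1
    ext f
    simp only [hA, Finset.mem_filter, Finset.mem_univ, true_and, Fintype.mem_piFinset, funext_iff]
    constructor
    · exact fun h i => ⟨h.2 i, h.1.2 i⟩
    · intro h
      refine ⟨⟨?_, fun i => (h i).2⟩, fun i => (h i).1⟩
      exact (Finset.sum_congr rfl fun i _ => (h i).1).trans hc
  have h2 : (mk fun m => (κ m : ℤ)) ^ k = ∏ _i : Fin k, mk fun m => (κ m : ℤ) := by simp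
  rw [h2, coeff_prod, h1]
  push_cast
  symm
  refine Finset.sum_nbij (fun c i => c i) ?_ ?_ ?_ ?_
  · intro c hc
    simpa using hc
  · intro c _ d _ h
    exact DFunLike.coe_injective h
  · intro c hc
    refine ⟨Finsupp.equivFunOnFinite.symm c, ?_, rfl⟩
    simpa using hc
  · intro c _
    simp
end

theorem stmt_6 : ∀ n : ℕ, 25 ∣ numA 5 3 (125 * n + 122) := by
  intro n
  have h25 : (25 : PowerSeries (ZMod 25)) = 0 := by
    rw [← map_ofNat (PowerSeries.C (R := ZMod 25)) 25, show (OfNat.ofNat 25 : ZMod 25) = 0 from rfl,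
      map_zero]
  set G : PowerSeries (ZMod 25) :=
    .mk fun m => (Nat.card {p : m.Partition // IsTCore 5 p} : ZMod 25) with hG
  have hcore := mk_mul_pentagonalSeries (R := ZMod 25)
    (fun m => Nat.card {p : m.Partition // IsTCore 5 p}) fun m M h => card_isTCore_five h
  have h0 := coeff_cube_eq_zero h25 (PowerSeries.X * G) (by rw [mul_assoc, hcore]) (n + 1)
  rw [mul_pow, show 125 * (n + 1) = (125 * n + 122) + 3 by ring, PowerSeries.coeff_X_pow_mul] at h0
  rw [← ZMod.natCast_eq_zero_iff, ← h0]
  have h1 := congrArg (Int.castRingHom (ZMod 25)) (numA_eq_coeff 5 3 (125 * n + 122))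
  rw [← PowerSeries.coeff_map, map_pow] at h1
  have h2 : PowerSeries.map (Int.castRingHom (ZMod 25))
      (.mk fun m => (Nat.card {p : m.Partition // IsTCore 5 p} : ℤ)) = G := by
    ext m; simp [hG]
  rw [h2] at h1
  simpa using h1
end

section
/- For all integers n ≥ 0, A_{5,4}(25n + 21) ≡ 0 (mod 3125). -/
namespace FiveCore

open PowerSeries Finset

/-- The power series `F` only involves exponents congruent to `r` modulo `5`. -/
def SupportedOn {R : Type*} [Semiring R] (r : ZMod 5) (F : R⟦X⟧) : Prop :=
  ∀ n : ℕ, coeff n F ≠ 0 → (n : ZMod 5) = r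

section SupportedOn

variable {R : Type*} [CommRing R] {r s : ZMod 5} {F G : R⟦X⟧}

theorem SupportedOn.mul (hF : SupportedOn r F) (hG : SupportedOn s G) :
    SupportedOn (r + s) (F * G) := by
  intro n hn
  rw [coeff_mul] at hn
  obtain ⟨⟨a, b⟩, hab, h⟩ := Finset.exists_ne_zero_of_sum_ne_zero hn
  rw [HasAntidiagonal.mem_antidiagonal] at hab
  rw [← hab, ← hF a (left_ne_zero_of_mul h), ← hG b (right_ne_zero_of_mul h)]
  push_cast
  rfl

theorem SupportedOn.add (hF : SupportedOn r F) (hG : SupportedOn r G) :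
    SupportedOn r (F + G) := by
  intro n hn
  by_cases h : coeff n F = 0
  · exact hG n (by simpa [h] using hn)
  · exact hF n h

theorem SupportedOn.neg (hF : SupportedOn r F) : SupportedOn r (-F) := by
  intro n hn
  exact hF n (by simpa using hn)

theorem SupportedOn.pow (hF : SupportedOn r F) (k : ℕ) :
    SupportedOn (k * r) (F ^ k) := by
  induction k with
  | zero =>
    intro n hn
    have : n = 0 := by
      by_contra h
      simp [coeff_one, h] at hn
    simp [this]
  | succ k ih =>
    rw [pow_succ]
    convert ih.mul hF using 1
    push_cast
    ring

theorem supportedOn_X : SupportedOn 1 (X : R⟦X⟧) := by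
  intro n hn
  have : n = 1 := by
    by_contra h
    simp [coeff_X, h] at hn
  simp [this]

theorem supportedOn_expand (F : R⟦X⟧) : SupportedOn 0 (expand 5 (by norm_num) F) := by
  intro n hn
  rw [coeff_expand] at hn
  have : 5 ∣ n := by
    by_contra h
    simp [h] at hn
  exact (ZMod.natCast_eq_zero_iff n 5).2 this

end SupportedOn

theorem abs_le_pentagonal (m : ℤ) : |m| ≤ pentagonal m := by
  have h := two_mul_natCast_pentagonal m
  rcases abs_cases m with ⟨h1, h2⟩ | ⟨h1, h2⟩ <;> rw [h1]
  · rcases h2.eq_or_lt with h2 | h2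
    · subst h2; positivity
    · nlinarith
  · nlinarith

theorem mem_Icc_of_pentagonal_le {m : ℤ} {N : ℕ} (h : pentagonal m ≤ N) :
    m ∈ Icc (-N : ℤ) N := by
  have h1 := abs_le_pentagonal m
  have h2 : (pentagonal m : ℤ) ≤ N := by exact_mod_cast h
  rw [mem_Icc]
  exact abs_le.1 (h1.trans h2)

/-- The part of the pentagonal number series indexed by the integers congruent to `r`
modulo `5`. -/
noncomputable def pentagonalPart (r : ZMod 5) : ℤ⟦X⟧ :=
  .mk fun n ↦ ∑ m ∈ Icc (-n : ℤ) n with (((m : ℤ) : ZMod 5) = r ∧ pentagonal m = n),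
    (m.negOnePow : ℤ)

theorem coeff_pentagonalPart {r : ZMod 5} {n N : ℕ} (h : n ≤ N) :
    coeff n (pentagonalPart r) =
      ∑ m ∈ Icc (-N : ℤ) N with (((m : ℤ) : ZMod 5) = r ∧ pentagonal m = n), (m.negOnePow : ℤ) := by
  rw [pentagonalPart, coeff_mk]
  congr 1
  ext m
  simp only [mem_filter]
  constructor
  · rintro ⟨-, h1, h2⟩
    exact ⟨mem_Icc_of_pentagonal_le (h2.trans_le h), h1, h2⟩
  · rintro ⟨-, h1, h2⟩
    exact ⟨mem_Icc_of_pentagonal_le h2.le, h1, h2⟩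

theorem coeff_pentagonalPart_mul (r s : ZMod 5) (n : ℕ) :
    coeff n (pentagonalPart r * pentagonalPart s) =
      ∑ p ∈ Icc (-n : ℤ) n ×ˢ Icc (-n : ℤ) n with
        ((p.1 : ZMod 5) = r ∧ (p.2 : ZMod 5) = s ∧ pentagonal p.1 + pentagonal p.2 = n),
        ((p.1 + p.2).negOnePow : ℤ) := by
  rw [coeff_mul]
  have : ∀ x ∈ antidiagonal n, coeff x.1 (pentagonalPart r) * coeff x.2 (pentagonalPart s) =
      ∑ p ∈ Icc (-n : ℤ) n ×ˢ Icc (-n : ℤ) n with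
        (((p.1 : ZMod 5) = r ∧ pentagonal p.1 = x.1) ∧
          ((p.2 : ZMod 5) = s ∧ pentagonal p.2 = x.2)),
        ((p.1 + p.2).negOnePow : ℤ) := by
    intro x hx
    rw [coeff_pentagonalPart (HasAntidiagonal.antidiagonal.fst_le hx),
      coeff_pentagonalPart (HasAntidiagonal.antidiagonal.snd_le hx), Finset.sum_mul_sum,
      ← Finset.sum_product',
      ← Finset.filter_product]
    simp [Int.negOnePow_add]
  rw [Finset.sum_congr rfl this, Finset.sum_sigma']
  refine Finset.sum_bij' (fun a _ ↦ a.2) (fun p _ ↦ ⟨(pentagonal p.1, pentagonal p.2), p⟩)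
    ?_ ?_ ?_ ?_ ?_
  · rintro ⟨⟨a, b⟩, p⟩ h
    simp only [mem_sigma, HasAntidiagonal.mem_antidiagonal, mem_filter] at h ⊢
    obtain ⟨h1, h2, ⟨h3, h4⟩, h5, h6⟩ := h
    exact ⟨h2, h3, h5, by rw [h4, h6, h1]⟩
  · rintro p h
    simp only [mem_sigma, HasAntidiagonal.mem_antidiagonal, mem_filter] at h ⊢
    obtain ⟨h1, h2, h3, h4⟩ := h
    exact ⟨h4, h1, ⟨h2, trivial⟩, h3, trivial⟩
  · rintro ⟨⟨a, b⟩, p⟩ h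
    simp only [mem_sigma, HasAntidiagonal.mem_antidiagonal, mem_filter] at h ⊢
    obtain ⟨h1, h2, ⟨h3, h4⟩, h5, h6⟩ := h
    simp [h4, h6]
  · intros; rfl
  · intros; rfl

theorem sum_pentagonalPart_mul :
    ∑ r : ZMod 5, pentagonalPart r * pentagonalPart (2 * r - 1) = 0 := by
  ext n
  rw [map_sum, map_zero]
  simp_rw [coeff_pentagonalPart_mul]
  have key : ∀ r : ZMod 5, ∑ p ∈ Icc (-n : ℤ) n ×ˢ Icc (-n : ℤ) n with
        ((p.1 : ZMod 5) = r ∧ (p.2 : ZMod 5) = 2 * r - 1 ∧ pentagonal p.1 + pentagonal p.2 = n),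
        ((p.1 + p.2).negOnePow : ℤ) =
      ∑ p ∈ (Icc (-n : ℤ) n ×ˢ Icc (-n : ℤ) n).filter (fun p ↦
        ((p.2 : ZMod 5) = 2 * p.1 - 1 ∧ pentagonal p.1 + pentagonal p.2 = n)) with
        ((p.1 : ZMod 5) = r),
        ((p.1 + p.2).negOnePow : ℤ) := by
    intro r
    rw [filter_filter]
    congr 1
    apply filter_congr
    rintro p -
    constructor
    · rintro ⟨rfl, h1, h2⟩
      exact ⟨⟨h1, h2⟩, rfl⟩
    · rintro ⟨⟨h1, h2⟩, rfl⟩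
      exact ⟨rfl, h1, h2⟩
  rw [Finset.sum_congr rfl fun r _ ↦ key r,
    Finset.sum_fiberwise]
  have hdvd : ∀ p : ℤ × ℤ, (p.2 : ZMod 5) = 2 * p.1 - 1 → ∃ k : ℤ, p.2 = 2 * p.1 - 1 + 5 * k := by
    intro p hp
    have : ((2 * p.1 - 1 : ℤ) : ZMod 5) = p.2 := by push_cast; exact hp.symm
    obtain ⟨k, hk⟩ := (ZMod.intCast_eq_intCast_iff_dvd_sub _ _ 5).1 this
    exact ⟨k, by push_cast at hk; linarith⟩
  refine Finset.sum_involution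
    (fun p _ ↦ ((3 * p.1 - 4 * p.2 + 1) / 5, (2 - 4 * p.1 - 3 * p.2) / 5)) ?_ ?_ ?_ ?_
  all_goals
    rintro ⟨a, b⟩ h
    simp only [mem_filter] at h
    obtain ⟨-, h1, h2⟩ := h
    obtain ⟨k, hk⟩ := hdvd (a, b) h1
    simp only at hk
    subst hk
    have e1 : (3 * a - 4 * (2 * a - 1 + 5 * k) + 1) / 5 = 1 - a - 4 * k := by omega
    have e2 : (2 - 4 * a - 3 * (2 * a - 1 + 5 * k)) / 5 = 1 - 2 * a - 3 * k := by omega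
    simp only [e1, e2]
  · have : 1 - a - 4 * k + (1 - 2 * a - 3 * k) =
        (a + (2 * a - 1 + 5 * k)) + (2 * (-3 * a - 6 * k + 1) + 1) := by
      ring
    rw [this, Int.negOnePow_add _ (2 * _ + 1), Int.negOnePow_odd _ ⟨_, rfl⟩]
    simp
  · intro _ h3
    rw [Prod.mk.injEq] at h3
    omega
  · have hpent : pentagonal (1 - a - 4 * k) + pentagonal (1 - 2 * a - 3 * k) = n := by
      have g1 := two_mul_natCast_pentagonal a
      have g2 := two_mul_natCast_pentagonal (2 * a - 1 + 5 * k)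
      have g3 := two_mul_natCast_pentagonal (1 - a - 4 * k)
      have g4 := two_mul_natCast_pentagonal (1 - 2 * a - 3 * k)
      have h2' : (pentagonal a : ℤ) + pentagonal (2 * a - 1 + 5 * k) = n := by exact_mod_cast h2
      have : (pentagonal (1 - a - 4 * k) : ℤ) + pentagonal (1 - 2 * a - 3 * k) = n := by
        linarith
      exact_mod_cast this
    rw [mem_filter, mem_product]
    refine ⟨⟨mem_Icc_of_pentagonal_le (by simp only; omega),
      mem_Icc_of_pentagonal_le (by simp only; omega)⟩, ?_, hpent⟩
    push_cast
    have : (5 : ZMod 5) = 0 := rfl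
    linear_combination (k : ZMod 5) * this
  · rw [Prod.mk.injEq]
    omega

theorem sum_pentagonalPart : ∑ r : ZMod 5, pentagonalPart r = pentagonalSeries ℤ := by
  ext n
  rw [map_sum]
  simp_rw [coeff_pentagonalPart le_rfl, and_comm (b := pentagonal _ = n), ← filter_filter]
  rw [Finset.sum_fiberwise]
  by_cases h : n ∈ Set.range pentagonal
  · obtain ⟨k, rfl⟩ := h
    rw [coeff_pentagonalSeries_pentagonal]
    rw [Finset.sum_eq_single k]
    · exact (Int.cast_id).symm
    · intro m hm hmk
      exact absurd (pentagonal_injective (mem_filter.1 hm).2) hmk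
    · intro hk
      exact absurd (mem_filter.2 ⟨mem_Icc_of_pentagonal_le (le_refl _), rfl⟩ :
        k ∈ filter (fun m ↦ pentagonal m = pentagonal k) _) hk
  · rw [coeff_pentagonalSeries_eq_zero ℤ h, filter_false_of_mem, sum_empty]
    intro m _ hm
    exact h ⟨m, hm⟩

theorem supportedOn_pentagonalPart (r : ZMod 5) :
    SupportedOn (4 * r ^ 2 + 2 * r) (pentagonalPart r) := by
  intro n hn
  rw [coeff_pentagonalPart le_rfl] at hn
  obtain ⟨m, hm, -⟩ := Finset.exists_ne_zero_of_sum_ne_zero hn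
  obtain ⟨-, rfl, rfl⟩ := mem_filter.1 hm
  have h := congrArg (Int.cast : ℤ → ZMod 5) (two_mul_natCast_pentagonal m)
  push_cast at h
  have h5 : (5 : ZMod 5) = 0 := rfl
  linear_combination 3 * h + (-(pentagonal m : ZMod 5) + (m : ZMod 5) ^ 2 - m) * h5

theorem pentagonalPart_one :
    pentagonalPart 1 = -(X * expand 25 (by norm_num) (pentagonalSeries ℤ)) := by
  ext n
  rw [coeff_pentagonalPart le_rfl, map_neg]
  have hk : ∀ k : ℤ, pentagonal (1 - 5 * k) = 25 * pentagonal k + 1 := by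
    intro k
    have g1 := two_mul_natCast_pentagonal k
    have g2 := two_mul_natCast_pentagonal (1 - 5 * k)
    zify
    linarith
  have hm1 : ∀ m : ℤ, (m : ZMod 5) = 1 → ∃ k : ℤ, m = 1 - 5 * k := by
    intro m hm
    have : ((1 : ℤ) : ZMod 5) = m := by push_cast; exact hm.symm
    obtain ⟨k, hk⟩ := (ZMod.intCast_eq_intCast_iff_dvd_sub _ _ 5).1 this
    exact ⟨-k, by push_cast at hk; linarith⟩
  by_cases h : ∃ k, n = 25 * pentagonal k + 1
  · obtain ⟨k, rfl⟩ := h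
    rw [Finset.sum_eq_single (1 - 5 * k)]
    · rw [coeff_succ_X_mul, coeff_expand_mul, coeff_pentagonalSeries_pentagonal]
      have : 1 - 5 * k = k + (2 * (-3 * k) + 1) := by ring
      rw [this, Int.negOnePow_add, Int.negOnePow_odd _ ⟨_, rfl⟩]
      simp only [mul_neg, mul_one, Units.val_neg, Int.cast_id]
    · intro m hm hmk
      rw [← hk] at hm
      exact absurd (pentagonal_injective (mem_filter.1 hm).2.2) hmk
    · intro h'
      refine absurd (mem_filter.2 ⟨mem_Icc_of_pentagonal_le (hk k).le, ?_, hk k⟩) h'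
      push_cast
      have h5 : (5 : ZMod 5) = 0 := rfl
      rw [h5]; simp
  · rw [filter_false_of_mem, sum_empty]
    · cases n with
      | zero => simp
      | succ n =>
        rw [coeff_succ_X_mul, coeff_expand]
        split_ifs with hd
        · obtain ⟨d, rfl⟩ := hd
          rw [Nat.mul_div_cancel_left _ (by norm_num), coeff_pentagonalSeries_eq_zero, neg_zero]
          rintro ⟨k, rfl⟩
          exact h ⟨k, rfl⟩
        · simp
    · rintro m - ⟨h1, h2⟩
      obtain ⟨k, rfl⟩ := hm1 m h1
      exact h ⟨k, by rw [← h2, hk]⟩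

/-- The 5-dissection of Euler's function. -/
theorem exists_dissection :
    ∃ a b : ℤ⟦X⟧, SupportedOn 0 a ∧ SupportedOn 2 b ∧
      pentagonalSeries ℤ = a - X * expand 25 (by norm_num) (pentagonalSeries ℤ) + b ∧
      a * b = -(X * expand 25 (by norm_num) (pentagonalSeries ℤ)) ^ 2 := by
  have h0 := sum_pentagonalPart_mul
  have h1 := sum_pentagonalPart
  have hsum : ∀ F : ZMod 5 → ℤ⟦X⟧, ∑ r, F r = F 0 + F 1 + F 2 + F 3 + F 4 := fun F ↦
    Fin.sum_univ_five F
  rw [hsum] at h0 h1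
  rw [show (2 * 0 - 1 : ZMod 5) = 4 by decide, show (2 * 1 - 1 : ZMod 5) = 1 by decide,
    show (2 * 2 - 1 : ZMod 5) = 3 by decide, show (2 * 3 - 1 : ZMod 5) = 0 by decide,
    show (2 * 4 - 1 : ZMod 5) = 2 by decide] at h0
  have hone := pentagonalPart_one
  have hs := supportedOn_pentagonalPart
  refine ⟨pentagonalPart 0 + pentagonalPart 2, pentagonalPart 3 + pentagonalPart 4,
    (hs 0).add (hs 2), (hs 3).add (hs 4), ?_, ?_⟩
  · linear_combination hone - h1
  · linear_combination h0 - (pentagonalPart 1 -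
      X * expand 25 (by norm_num) (pentagonalSeries ℤ)) * hone

theorem SupportedOn.rescale_eq {R : Type*} [CommRing R] {r : ℕ} {F : R⟦X⟧} {ω : R}
    (hω : ω ^ 5 = 1) (hF : SupportedOn (r : ZMod 5) F) : rescale ω F = C (ω ^ r) * F := by
  ext n
  rw [coeff_rescale, coeff_C_mul]
  by_cases h : coeff n F = 0
  · simp [h]
  · have h1 := (ZMod.natCast_eq_natCast_iff' n r 5).1 (hF n h)
    rw [← Nat.div_add_mod n 5, ← Nat.div_add_mod r 5, h1, pow_add, pow_add, pow_mul, pow_mul, hω]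
    simp

theorem SupportedOn.map {R S : Type*} [CommRing R] [CommRing S] {r : ZMod 5} {F : R⟦X⟧}
    (hF : SupportedOn r F) (φ : R →+* S) : SupportedOn r (PowerSeries.map φ F) := by
  intro n hn
  apply hF n
  intro h
  simp [h] at hn

/-- The product of the five conjugates of a power series under `X ↦ ω X`. -/
noncomputable def conjProd {R : Type*} [CommRing R] (ω : R) (F : R⟦X⟧) : R⟦X⟧ :=
  ∏ i ∈ range 5, rescale (ω ^ i) F

section conjProd

variable {R : Type*} [CommRing R] {ω : R}

theorem conjProd_mul (F G : R⟦X⟧) : conjProd ω (F * G) = conjProd ω F * conjProd ω G := by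
  simp [conjProd, Finset.prod_mul_distrib]

theorem conjProd_of_supportedOn (h5 : ω ^ 5 = 1) (hs : 1 + ω + ω ^ 2 + ω ^ 3 + ω ^ 4 = 0)
    {a b c : R⟦X⟧} (ha : SupportedOn 0 a) (hb : SupportedOn 1 b) (hc : SupportedOn 2 c) :
    conjProd ω (a + b + c) =
      a ^ 5 + b ^ 5 + c ^ 5 - 5 * (a * b ^ 3 * c) + 5 * (a ^ 2 * b * c ^ 2) := by
  have hpow : ∀ i, (ω ^ i) ^ 5 = 1 := fun i ↦ by rw [← pow_mul, mul_comm, pow_mul, h5, one_pow]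
  have hr : ∀ i, rescale (ω ^ i) (a + b + c) =
      a + (C ω) ^ i * b + (C ω) ^ (2 * i) * c := fun i ↦ by
    rw [map_add, map_add,
      SupportedOn.rescale_eq (r := 0) (hpow i) (by simpa using ha),
      SupportedOn.rescale_eq (r := 1) (hpow i) (by simpa using hb),
      SupportedOn.rescale_eq (r := 2) (hpow i) (by simpa using hc)]
    simp [pow_mul']
  have h5' : (C ω : R⟦X⟧) ^ 5 = 1 := by rw [← map_pow, h5, map_one]
  have hs' : 1 + (C ω : R⟦X⟧) + C ω ^ 2 + C ω ^ 3 + C ω ^ 4 = 0 := by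
    simpa using congrArg (C : R → R⟦X⟧) hs
  rw [conjProd, Finset.prod_congr rfl fun i _ ↦ hr i]
  simp only [Finset.prod_range_succ, Finset.prod_range_zero]
  generalize (C ω : R⟦X⟧) = W at *
  have p1 : (a + W ^ 1 * b + W ^ (2 * 1) * c) * (a + W ^ 4 * b + W ^ (2 * 4) * c) =
      a ^ 2 + b ^ 2 + c ^ 2 + (W + W ^ 4) * (a * b + b * c) + (W ^ 2 + W ^ 3) * (a * c) := by
    linear_combination (b ^ 2 + c ^ 2 * (W ^ 5 + 1) + a * c * W ^ 3 + b * c * (W ^ 4 + W)) * h5'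
  have p2 : (a + W ^ 2 * b + W ^ (2 * 2) * c) * (a + W ^ 3 * b + W ^ (2 * 3) * c) =
      a ^ 2 + b ^ 2 + c ^ 2 + (W ^ 2 + W ^ 3) * (a * b + b * c) + (W + W ^ 4) * (a * c) := by
    linear_combination (b ^ 2 + c ^ 2 * (W ^ 5 + 1) + a * c * W + b * c * (W ^ 3 + W ^ 2)) * h5'
  have t1 : W + W ^ 4 + (W ^ 2 + W ^ 3) = -1 := by linear_combination hs'
  have t2 : (W + W ^ 4) * (W ^ 2 + W ^ 3) = -1 := by
    linear_combination hs' + (W + W ^ 2) * h5'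
  generalize W + W ^ 4 = x at *
  generalize W ^ 2 + W ^ 3 = y at *
  obtain rfl : y = -1 - x := by linear_combination t1
  have t3 : x ^ 2 = 1 - x := by linear_combination -t2
  linear_combination (a + b + c) * (a + W ^ 2 * b + W ^ (2 * 2) * c) *
    (a + W ^ 3 * b + W ^ (2 * 3) * c) * p1 +
      (a + b + c) * (a ^ 2 + b ^ 2 + c ^ 2 + x * (a * b + b * c) + (-1 - x) * (a * c)) * p2
    - (a + b + c) * (a * b + b * c - a * c) ^ 2 * t3

theorem prod_one_sub_pow_mul {A : Type*} [CommRing A] {η : A}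
    (hs : 1 + η + η ^ 2 + η ^ 3 + η ^ 4 = 0) (z : A) :
    ∏ i ∈ range 5, (1 - η ^ i * z) = 1 - z ^ 5 := by
  have h5 : η ^ 5 = 1 := by linear_combination (η - 1) * hs
  simp only [Finset.prod_range_succ, Finset.prod_range_zero]
  have p1 : (1 - η ^ 1 * z) * (1 - η ^ 4 * z) = 1 - (η + η ^ 4) * z + z ^ 2 := by
    linear_combination z ^ 2 * h5
  have p2 : (1 - η ^ 2 * z) * (1 - η ^ 3 * z) = 1 - (η ^ 2 + η ^ 3) * z + z ^ 2 := by
    linear_combination z ^ 2 * h5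
  have t1 : η + η ^ 4 + (η ^ 2 + η ^ 3) = -1 := by linear_combination hs
  have t2 : (η + η ^ 4) * (η ^ 2 + η ^ 3) = -1 := by
    linear_combination hs + (η + η ^ 2) * h5
  generalize η + η ^ 4 = x at *
  generalize η ^ 2 + η ^ 3 = y at *
  linear_combination (1 - z) * (1 - η ^ 2 * z) * (1 - η ^ 3 * z) * p1 +
    (1 - z) * (1 - x * z + z ^ 2) * p2 - (1 - z) * (z + z ^ 3) * t1 + (1 - z) * z ^ 2 * t2

theorem conjProd_one_sub_X_pow_of_not_dvd (h5 : ω ^ 5 = 1)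
    (hs : 1 + ω + ω ^ 2 + ω ^ 3 + ω ^ 4 = 0) {n : ℕ} (hn : ¬ 5 ∣ n) :
    conjProd ω (1 - X ^ n : R⟦X⟧) = 1 - X ^ (5 * n) := by
  have hη : 1 + ω ^ n + (ω ^ n) ^ 2 + (ω ^ n) ^ 3 + (ω ^ n) ^ 4 = 0 := by
    have hmod : ω ^ n = ω ^ (n % 5) := by
      conv_lhs => rw [← Nat.div_add_mod n 5, pow_add, pow_mul, h5, one_pow, one_mul]
    have : n % 5 = 1 ∨ n % 5 = 2 ∨ n % 5 = 3 ∨ n % 5 = 4 := by omega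
    rw [hmod]
    rcases this with h | h | h | h <;> rw [h]
    · linear_combination hs
    · linear_combination hs + (ω + ω ^ 3) * h5
    · linear_combination hs + (ω + ω ^ 4 + ω ^ 2 * (ω ^ 5 + 1)) * h5
    · linear_combination hs + (ω ^ 3 + ω ^ 2 * (ω ^ 5 + 1) + ω * (ω ^ 10 + ω ^ 5 + 1)) * h5
  have hC : 1 + C (ω ^ n) + C (ω ^ n) ^ 2 + C (ω ^ n) ^ 3 + C (ω ^ n) ^ 4 = (0 : R⟦X⟧) := by
    simpa using congrArg (C : R → R⟦X⟧) hη
  rw [conjProd, mul_comm 5 n, pow_mul, ← prod_one_sub_pow_mul hC]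
  refine Finset.prod_congr rfl fun i _ ↦ ?_
  rw [map_sub, map_one, map_pow, rescale_X, mul_pow, ← map_pow, ← map_pow, ← pow_mul, ← pow_mul,
    mul_comm i n]

theorem conjProd_one_sub_X_pow_mul_five (h5 : ω ^ 5 = 1) (n : ℕ) :
    conjProd ω (1 - X ^ (5 * n) : R⟦X⟧) = (1 - X ^ (5 * n)) ^ 5 := by
  have : ∀ i ∈ range 5, rescale (ω ^ i) (1 - X ^ (5 * n) : R⟦X⟧) = 1 - X ^ (5 * n) := by
    intro i _
    rw [map_sub, map_one, map_pow, rescale_X, mul_pow, ← map_pow, ← pow_mul, mul_left_comm,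
      pow_mul ω, h5, one_pow, map_one, one_mul]
  rw [conjProd, Finset.prod_congr rfl this]
  simp

theorem conjProd_prod_one_sub_X_pow (h5 : ω ^ 5 = 1)
    (hs : 1 + ω + ω ^ 2 + ω ^ 3 + ω ^ 4 = 0) (M : ℕ) :
    conjProd ω (∏ n ∈ range (5 * M), (1 - X ^ (n + 1) : R⟦X⟧)) *
        expand 25 (by norm_num) (∏ n ∈ range M, (1 - X ^ (n + 1) : R⟦X⟧)) =
      expand 5 (by norm_num) (∏ n ∈ range (5 * M), (1 - X ^ (n + 1) : R⟦X⟧)) *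
        expand 5 (by norm_num) (∏ n ∈ range M, (1 - X ^ (n + 1) : R⟦X⟧)) ^ 5 := by
  induction M with
  | zero => simp [conjProd]
  | succ M ih =>
    rw [show 5 * (M + 1) = 5 * M + 1 + 1 + 1 + 1 + 1 by ring]
    simp only [Finset.prod_range_succ _ (5 * M), Finset.prod_range_succ _ (5 * M + 1),
      Finset.prod_range_succ _ (5 * M + 1 + 1), Finset.prod_range_succ _ (5 * M + 1 + 1 + 1),
      Finset.prod_range_succ _ (5 * M + 1 + 1 + 1 + 1), Finset.prod_range_succ _ M, conjProd_mul,
      map_mul]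
    rw [conjProd_one_sub_X_pow_of_not_dvd h5 hs (by omega : ¬ 5 ∣ 5 * M + 1),
      conjProd_one_sub_X_pow_of_not_dvd h5 hs (by omega : ¬ 5 ∣ 5 * M + 1 + 1),
      conjProd_one_sub_X_pow_of_not_dvd h5 hs (by omega : ¬ 5 ∣ 5 * M + 1 + 1 + 1),
      conjProd_one_sub_X_pow_of_not_dvd h5 hs (by omega : ¬ 5 ∣ 5 * M + 1 + 1 + 1 + 1),
      show 5 * M + 1 + 1 + 1 + 1 + 1 = 5 * (M + 1) by ring, conjProd_one_sub_X_pow_mul_five h5]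
    simp only [map_sub, map_one, map_pow, expand_X, ← pow_mul, mul_pow]
    rw [show 5 * (5 * (M + 1)) = 25 * (M + 1) by ring]
    generalize (1 - X ^ (25 * (M + 1)) : R⟦X⟧) = Z
    generalize (1 - X ^ (5 * (M + 1)) : R⟦X⟧) ^ 5 = Y
    generalize (1 - X ^ (5 * (5 * M + 1)) : R⟦X⟧) = u1
    generalize (1 - X ^ (5 * (5 * M + 1 + 1)) : R⟦X⟧) = u2
    generalize (1 - X ^ (5 * (5 * M + 1 + 1 + 1)) : R⟦X⟧) = u3
    generalize (1 - X ^ (5 * (5 * M + 1 + 1 + 1 + 1)) : R⟦X⟧) = u4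
    linear_combination u1 * u2 * u3 * u4 * Y * Z * ih

end conjProd

open Filter Topology PowerSeries.WithPiTopology in
theorem conjProd_pentagonalSeries {ω : ℂ} (h5 : ω ^ 5 = 1)
    (hs : 1 + ω + ω ^ 2 + ω ^ 3 + ω ^ 4 = 0) :
    conjProd ω (pentagonalSeries ℂ) * expand 25 (by norm_num) (pentagonalSeries ℂ) =
      expand 5 (by norm_num) (pentagonalSeries ℂ) ^ 6 := by
  have h1 : Tendsto (fun M ↦ ∏ n ∈ range M, (1 - X ^ (n + 1) : ℂ⟦X⟧)) atTop
      (𝓝 (pentagonalSeries ℂ)) := (hasProd_one_sub_X_pow ℂ).tendsto_prod_nat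
  have h2 : Tendsto (fun M ↦ ∏ n ∈ range (5 * M), (1 - X ^ (n + 1) : ℂ⟦X⟧)) atTop
      (𝓝 (pentagonalSeries ℂ)) :=
    h1.comp (tendsto_id.const_mul_atTop' (by norm_num : 0 < 5))
  have hexp : ∀ (p : ℕ) (hp : p ≠ 0), Continuous (expand p hp : ℂ⟦X⟧ → ℂ⟦X⟧) := by
    intro p hp
    rw [continuous_iff_continuousAt]
    intro F
    rw [ContinuousAt, tendsto_iff_coeff_tendsto]
    intro d
    simp_rw [coeff_expand]
    split_ifs
    · exact (continuous_coeff ℂ _).continuousAt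
    · exact tendsto_const_nhds
  have hres : ∀ a : ℂ, Continuous (rescale a : ℂ⟦X⟧ → ℂ⟦X⟧) := by
    intro a
    rw [continuous_iff_continuousAt]
    intro F
    rw [ContinuousAt, tendsto_iff_coeff_tendsto]
    intro d
    simp_rw [coeff_rescale]
    exact (continuous_const.mul (continuous_coeff ℂ _)).continuousAt
  have hconj : Continuous (conjProd ω : ℂ⟦X⟧ → ℂ⟦X⟧) :=
    continuous_finsetProd _ fun i _ ↦ hres (ω ^ i)
  have hL := ((hconj.tendsto _).comp h2).mul (((hexp 25 (by norm_num)).tendsto _).comp h1)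
  have hR := (((hexp 5 (by norm_num)).tendsto _).comp h2).mul
    ((((hexp 5 (by norm_num)).tendsto _).comp h1).pow 5)
  have := tendsto_nhds_unique hL (hR.congr fun M ↦ (conjProd_prod_one_sub_X_pow h5 hs M).symm)
  rw [this]
  ring

theorem quintic_identity {A : Type*} [CommRing A] {a b w : A} (hab : a * b = -w ^ 2) :
    (a - w + b) ^ 5 + 5 * (a - w + b) ^ 4 * w + 15 * (a - w + b) ^ 3 * w ^ 2 +
        25 * (a - w + b) ^ 2 * w ^ 3 + 25 * (a - w + b) * w ^ 4 =
      a ^ 5 + (-w) ^ 5 + b ^ 5 - 5 * (a * (-w) ^ 3 * b) + 5 * (a ^ 2 * (-w) * b ^ 2) := by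
  linear_combination (5 * (a + b) ^ 3 + 5 * (a + b) * (w ^ 2 - a * b) +
    5 * w * (a * b - 2 * w ^ 2)) * hab

/-- The modular equation satisfied by Euler's function `f(X)` and `X f(X ^ 25)`. -/
theorem pentagonalSeries_modular_equation {f w h : ℤ⟦X⟧} (hf : f = pentagonalSeries ℤ)
    (hh : h = expand 25 (by norm_num) f) (hw : w = X * h) :
    (f ^ 5 + 5 * f ^ 4 * w + 15 * f ^ 3 * w ^ 2 + 25 * f ^ 2 * w ^ 3 + 25 * f * w ^ 4) * h =
      expand 5 (by norm_num) f ^ 6 := by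
  obtain ⟨a, b, ha, hb, hab, hmul⟩ := exists_dissection
  have hinj : Function.Injective (PowerSeries.map (Int.castRingHom ℂ)) :=
    PowerSeries.map_injective _ Int.cast_injective
  have hmapf : PowerSeries.map (Int.castRingHom ℂ) (pentagonalSeries ℤ) = pentagonalSeries ℂ := by
    ext n
    rw [coeff_map]
    by_cases hn : n ∈ Set.range pentagonal
    · obtain ⟨k, rfl⟩ := hn
      simp
    · simp [coeff_pentagonalSeries_eq_zero _ hn]
  obtain ⟨ω, hω⟩ : ∃ ω : ℂ, IsPrimitiveRoot ω 5 :=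
    ⟨_, Complex.isPrimitiveRoot_exp 5 (by norm_num)⟩
  have hs : 1 + ω + ω ^ 2 + ω ^ 3 + ω ^ 4 = 0 := by
    have := hω.geom_sum_eq_zero (by norm_num)
    simpa [Finset.sum_range_succ] using this
  have hwc : SupportedOn 1 w := by
    rw [hw, hh]
    have h25 : expand 25 (by norm_num) f = expand 5 (by norm_num) (expand 5 (by norm_num) f) :=
      expand_mul 5 (by norm_num) 5 (by norm_num) f
    rw [h25]
    exact (supportedOn_X (R := ℤ)).mul (supportedOn_expand _)
  rw [← hf, ← hh, ← hw] at hab hmul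
  have key := conjProd_of_supportedOn hω.pow_eq_one hs
    (ha.map (Int.castRingHom ℂ)) (hwc.neg.map (Int.castRingHom ℂ)) (hb.map (Int.castRingHom ℂ))
  rw [← map_add, ← map_add, ← sub_eq_add_neg, ← hab, hf, hmapf] at key
  have hmain := conjProd_pentagonalSeries hω.pow_eq_one hs
  rw [key] at hmain
  have hz : (a ^ 5 + (-w) ^ 5 + b ^ 5 - 5 * (a * (-w) ^ 3 * b) + 5 * (a ^ 2 * (-w) * b ^ 2)) * h =
      expand 5 (by norm_num) f ^ 6 := by
    apply hinj
    have hh' : PowerSeries.map (Int.castRingHom ℂ) h = expand 25 (by norm_num)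
        (pentagonalSeries ℂ) := by rw [hh, hf, map_expand, hmapf]
    have hk' : PowerSeries.map (Int.castRingHom ℂ) (expand 5 (by norm_num) f) =
        expand 5 (by norm_num) (pentagonalSeries ℂ) := by rw [hf, map_expand, hmapf]
    rw [map_mul, map_pow, hh', hk', ← hmain]
    simp only [map_mul, map_add, map_sub, map_pow, map_neg, map_ofNat]
  rw [← hz, hab, quintic_identity hmul]

/-- The operator extracting every fifth coefficient of a power series. -/
noncomputable def fifthPart : ℤ⟦X⟧ →+ ℤ⟦X⟧ where
  toFun F := mk fun n ↦ coeff (5 * n) F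
  map_zero' := by ext; simp
  map_add' F G := by ext; simp

theorem coeff_fifthPart (F : ℤ⟦X⟧) (n : ℕ) : coeff n (fifthPart F) = coeff (5 * n) F := by
  simp [fifthPart]

theorem fifthPart_expand_mul (A F : ℤ⟦X⟧) :
    fifthPart (expand 5 (by norm_num) A * F) = A * fifthPart F := by
  ext n
  rw [coeff_fifthPart, coeff_mul, coeff_mul]
  symm
  refine Finset.sum_of_injOn (fun p ↦ (5 * p.1, 5 * p.2)) ?_ ?_ ?_ ?_
  · rintro ⟨a, b⟩ - ⟨c, d⟩ - h
    simp only [Prod.mk.injEq] at h ⊢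
    omega
  · rintro ⟨a, b⟩ h
    simp only [mem_coe, HasAntidiagonal.mem_antidiagonal] at h ⊢
    omega
  · rintro ⟨a, b⟩ h h'
    rw [HasAntidiagonal.mem_antidiagonal] at h
    rw [coeff_expand, if_neg, zero_mul]
    rintro ⟨c, rfl⟩
    dsimp only at h
    refine h' ⟨(c, n - c), ?_, ?_⟩
    · simp only [mem_coe, HasAntidiagonal.mem_antidiagonal]
      omega
    · simp only [Prod.mk.injEq, true_and]
      omega
  · rintro ⟨a, b⟩ -
    rw [coeff_fifthPart, coeff_expand_mul]

theorem fifthPart_eq_zero {r : ZMod 5} (hr : r ≠ 0) {F : ℤ⟦X⟧} (hF : SupportedOn r F) :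
    fifthPart F = 0 := by
  ext n
  rw [coeff_fifthPart, map_zero]
  by_contra h
  have := hF _ h
  apply hr
  rw [← this]
  push_cast
  rw [show (5 : ZMod 5) = 0 from rfl, zero_mul]

/-- `fifthPart` of a homogeneous form of degree five in Euler's function and `w = X f(X²⁵)`,
whose coefficients are series in `X⁵`. -/
theorem fifthPart_of_eq {w F : ℤ⟦X⟧} (A₀ A₁ A₂ A₃ A₄ : ℤ⟦X⟧)
    (hw : w = X * expand 25 (by norm_num) (pentagonalSeries ℤ))
    (hF : F = expand 5 (by norm_num) A₀ * w ^ 5 +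
      expand 5 (by norm_num) A₁ * (pentagonalSeries ℤ * w ^ 4) +
      expand 5 (by norm_num) A₂ * (pentagonalSeries ℤ ^ 2 * w ^ 3) +
      expand 5 (by norm_num) A₃ * (pentagonalSeries ℤ ^ 3 * w ^ 2) +
      expand 5 (by norm_num) A₄ * (pentagonalSeries ℤ ^ 4 * w)) :
    fifthPart F = (A₀ - A₁ - A₂ + 5 * A₃ - 5 * A₄) *
      (X * expand 5 (by norm_num) (pentagonalSeries ℤ) ^ 5) := by
  obtain ⟨a, b, ha, hb, hab, hmul⟩ := exists_dissection
  have h25 : expand 25 (by norm_num) (pentagonalSeries ℤ) =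
      expand 5 (by norm_num) (expand 5 (by norm_num) (pentagonalSeries ℤ)) :=
    expand_mul 5 (by norm_num) 5 (by norm_num) _
  have hwc : SupportedOn 1 w := by
    rw [hw, h25]
    exact (supportedOn_X (R := ℤ)).mul (supportedOn_expand _)
  rw [← hw] at hab hmul
  have hv : w ^ 5 = expand 5 (by norm_num)
      (X * expand 5 (by norm_num) (pentagonalSeries ℤ) ^ 5) * 1 := by
    rw [hw, h25, map_mul, map_pow, expand_X]
    ring
  have hone : fifthPart 1 = 1 := by
    ext n
    rw [coeff_fifthPart, coeff_one, coeff_one]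
    simp
  have key : F = expand 5 (by norm_num) (A₀ - A₁ - A₂ + 5 * A₃ - 5 * A₄) * w ^ 5 +
      expand 5 (by norm_num) (A₁ - 2 * A₂ + 8 * A₄) * (a * w ^ 4 + b * w ^ 4) +
      expand 5 (by norm_num) (A₂ - 3 * A₃ + 2 * A₄) * (a ^ 2 * w ^ 3 + b ^ 2 * w ^ 3) +
      expand 5 (by norm_num) (A₃ - 4 * A₄) * (a ^ 3 * w ^ 2 + b ^ 3 * w ^ 2) +
      expand 5 (by norm_num) A₄ * (a ^ 4 * w + b ^ 4 * w) := by
    rw [hF, hab]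
    simp only [map_add, map_sub, map_mul, map_ofNat]
    generalize expand 5 (by norm_num) A₁ = B₁
    generalize expand 5 (by norm_num) A₂ = B₂
    generalize expand 5 (by norm_num) A₃ = B₃
    generalize expand 5 (by norm_num) A₄ = B₄
    linear_combination (2 * w ^ 3 * B₂ + w ^ 2 * (3 * (a + b) - 6 * w) * B₃ +
      w * (4 * (a ^ 2 + b ^ 2) + 6 * (a * b + w ^ 2) - 12 * (a + b) * w) * B₄) * hmul
  have e1 : fifthPart (a * w ^ 4) = 0 := fifthPart_eq_zero (by decide) (ha.mul (hwc.pow 4))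
  have e2 : fifthPart (b * w ^ 4) = 0 := fifthPart_eq_zero (by decide) (hb.mul (hwc.pow 4))
  have e3 : fifthPart (a ^ 2 * w ^ 3) = 0 :=
    fifthPart_eq_zero (by decide) ((ha.pow 2).mul (hwc.pow 3))
  have e4 : fifthPart (b ^ 2 * w ^ 3) = 0 :=
    fifthPart_eq_zero (by decide) ((hb.pow 2).mul (hwc.pow 3))
  have e5 : fifthPart (a ^ 3 * w ^ 2) = 0 :=
    fifthPart_eq_zero (by decide) ((ha.pow 3).mul (hwc.pow 2))
  have e6 : fifthPart (b ^ 3 * w ^ 2) = 0 :=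
    fifthPart_eq_zero (by decide) ((hb.pow 3).mul (hwc.pow 2))
  have e7 : fifthPart (a ^ 4 * w) = 0 := fifthPart_eq_zero (by decide) ((ha.pow 4).mul hwc)
  have e8 : fifthPart (b ^ 4 * w) = 0 := fifthPart_eq_zero (by decide) ((hb.pow 4).mul hwc)
  rw [key, hv]
  simp only [map_add fifthPart, fifthPart_expand_mul, e1, e2, e3, e4, e5, e6, e7, e8, hone]
  ring

theorem isUnit_pentagonalSeries : IsUnit (pentagonalSeries ℤ) := by
  rw [PowerSeries.isUnit_iff_constantCoeff, ← coeff_zero_eq_constantCoeff_apply,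
    show (0 : ℕ) = pentagonal 0 from rfl, coeff_pentagonalSeries_pentagonal]
  simp

set_option maxHeartbeats 400000 in
/-- The fourth power of a series `c` with `c f = f(X⁵)⁵` has coefficients divisible by `3125`
in the class `21` modulo `25`. -/
theorem dvd_coeff_pow_four {c : ℤ⟦X⟧}
    (hc : c * pentagonalSeries ℤ = expand 5 (by norm_num) (pentagonalSeries ℤ) ^ 5) (n : ℕ) :
    3125 ∣ coeff (25 * n + 21) (c ^ 4) := by
  obtain ⟨f', hf'⟩ := isUnit_iff_exists_inv.1 isUnit_pentagonalSeries
  have hmod := pentagonalSeries_modular_equation rfl rfl rfl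
  have hred := fun F A₀ A₁ A₂ A₃ A₄ ↦ fifthPart_of_eq (F := F) A₀ A₁ A₂ A₃ A₄ rfl
  have hE : expand 25 (by norm_num) (pentagonalSeries ℤ) =
      expand 5 (by norm_num) (expand 5 (by norm_num) (pentagonalSeries ℤ)) :=
    expand_mul 5 (by norm_num) 5 (by norm_num) _
  set f := pentagonalSeries ℤ
  have hk' : expand 5 (by norm_num) f * expand 5 (by norm_num) f' = 1 := by
    rw [← map_mul, hf', map_one]
  set k := expand 5 (by norm_num) f with hk
  set k' := expand 5 (by norm_num) f'
  have hh' : expand 5 (by norm_num) k * expand 5 (by norm_num) k' = 1 := by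
    rw [← map_mul, hk', map_one]
  rw [hE] at hmod hred
  set h := expand 5 (by norm_num) k with hh
  set w := X * h with hw
  set v := X * k ^ 5 with hv
  have hEv : expand 5 (by norm_num) v = w ^ 5 := by
    rw [hv, hw, map_mul, map_pow, expand_X]
    ring
  have hN : expand 5 (by norm_num) (f ^ 6 * k') =
      f ^ 5 + 5 * f ^ 4 * w + 15 * f ^ 3 * w ^ 2 + 25 * f ^ 2 * w ^ 3 + 25 * f * w ^ 4 := by
    rw [map_mul, map_pow, ← hk, ← hmod]
    linear_combination (f ^ 5 + 5 * f ^ 4 * w + 15 * f ^ 3 * w ^ 2 + 25 * f ^ 2 * w ^ 3 +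
      25 * f * w ^ 4) * hh'
  set t := f ^ 6 * k' with ht
  have h14 := hred (f ^ 14 * w) 0 (-100 * t ^ 2) (45 * t ^ 2 + 2500 * t * v)
    (-10 * t ^ 2 + 1250 * t * v) (t ^ 2 + 750 * t * v + 3125 * v ^ 2) (by
      simp only [map_zero, map_add, map_mul, map_neg, map_pow, map_ofNat, hEv, hN]
      ring)
  have h8 := hred (f ^ 8 * w ^ 2) 0 (10 * t) (-5 * t - 250 * v)
    (t - 125 * v) (-50 * v) (by
      simp only [map_zero, map_sub, map_mul, map_neg, map_ofNat, hEv, hN]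
      ring)
  have h4 := hred ((f ^ 4 + 5 * f ^ 3 * w + 15 * f ^ 2 * w ^ 2 + 25 * f * w ^ 3 +
      25 * w ^ 4) ^ 4 * w ^ 4)
    (5 * t ^ 3 + 1375 * t ^ 2 * v + 46875 * t * v ^ 2 + 390625 * v ^ 3)
    (t ^ 3 + 875 * t ^ 2 * v + 40625 * t * v ^ 2 + 390625 * v ^ 3)
    (375 * t ^ 2 * v + 21875 * t * v ^ 2 + 234375 * v ^ 3)
    (100 * t ^ 2 * v + 6875 * t * v ^ 2 + 78125 * v ^ 3)
    (15 * t ^ 2 * v + 1250 * t * v ^ 2 + 15625 * v ^ 3) (by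
      simp only [map_add, map_mul, map_pow, map_ofNat, hEv, hN]
      ring)
  have hkt : k * t = f ^ 6 := by
    rw [ht]
    linear_combination f ^ 6 * hk'
  have hf0 : f ≠ 0 := isUnit_pentagonalSeries.ne_zero
  clear_value t v w h k' k f
  have hD : f ^ 24 * fifthPart (X ^ 4 * c ^ 4) = f ^ 20 * fifthPart ((f ^ 4 + 5 * f ^ 3 * w +
      15 * f ^ 2 * w ^ 2 + 25 * f * w ^ 3 + 25 * w ^ 4) ^ 4 * w ^ 4) := by
    rw [← fifthPart_expand_mul, ← fifthPart_expand_mul, map_pow, map_pow, ← hk]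
    refine congrArg fifthPart ?_
    rw [show k ^ 24 = (k ^ 6) ^ 4 by ring, ← hmod, show k ^ 20 = (k ^ 5) ^ 4 by ring, ← hc, hw]
    ring
  have hUD : fifthPart (X ^ 4 * c ^ 4) =
      4 * (X * f ^ 14 * k ^ 2) + 550 * (X ^ 2 * f ^ 8 * k ^ 8) +
        3125 * (4 * (f ^ 2 * X ^ 3 * k ^ 14) + 25 * (f' ^ 4 * X ^ 4 * k ^ 20)) := by
    have hp : f ^ 4 * f' ^ 4 = 1 := by rw [← mul_pow, hf', one_pow]
    have t3 : t ^ 3 * v = X * f ^ 18 * k ^ 2 := by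
      rw [hv, show t ^ 3 * (X * k ^ 5) = X * (k * t) ^ 3 * k ^ 2 by ring, hkt]
      ring
    have t2 : t ^ 2 * v ^ 2 = X ^ 2 * f ^ 12 * k ^ 8 := by
      rw [hv, show t ^ 2 * (X * k ^ 5) ^ 2 = X ^ 2 * (k * t) ^ 2 * k ^ 8 by ring, hkt]
      ring
    have t1 : t * v ^ 3 = X ^ 3 * f ^ 6 * k ^ 14 := by
      rw [hv, show t * (X * k ^ 5) ^ 3 = X ^ 3 * (k * t) * k ^ 14 by ring, hkt]
    have t0 : v ^ 4 = X ^ 4 * k ^ 20 := by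
      rw [hv]
      ring
    apply mul_left_cancel₀ (pow_ne_zero 24 hf0)
    rw [hD, h4]
    linear_combination f ^ 20 * (4 * t3 + 550 * t2 + 12500 * t1 + 78125 * t0) -
      78125 * f ^ 20 * X ^ 4 * k ^ 20 * hp
  have u14 : fifthPart (X * f ^ 14 * k ^ 2) = 3125 * (-5 * (f ^ 2 * k' * v ^ 3)) := by
    have e1 : k * fifthPart (X * f ^ 14) = -15625 * v ^ 3 := by
      rw [← fifthPart_expand_mul, ← hh, show h * (X * f ^ 14) = f ^ 14 * w by rw [hw]; ring, h14]
      ring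
    have e2 : fifthPart (X * f ^ 14 * k ^ 2) = f ^ 2 * fifthPart (X * f ^ 14) := by
      rw [← fifthPart_expand_mul, map_pow, ← hk, mul_comm]
    rw [e2]
    linear_combination f ^ 2 * k' * e1 - f ^ 2 * fifthPart (X * f ^ 14) * hk'
  have u8 : fifthPart (X ^ 2 * f ^ 8 * k ^ 8) = -125 * (f ^ 8 * k' ^ 2 * v ^ 2) := by
    have e1 : k ^ 2 * fifthPart (X ^ 2 * f ^ 8) = -125 * v ^ 2 := by
      rw [← fifthPart_expand_mul, map_pow, ← hh,
        show h ^ 2 * (X ^ 2 * f ^ 8) = f ^ 8 * w ^ 2 by rw [hw]; ring, h8]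
      ring
    have e2 : fifthPart (X ^ 2 * f ^ 8 * k ^ 8) = f ^ 8 * fifthPart (X ^ 2 * f ^ 8) := by
      rw [← fifthPart_expand_mul, map_pow, ← hk, mul_comm]
    rw [e2]
    linear_combination f ^ 8 * k' ^ 2 * e1 -
      f ^ 8 * fifthPart (X ^ 2 * f ^ 8) * (k * k' + 1) * hk'
  have hmul : ∀ (m : ℕ) (F : ℤ⟦X⟧), fifthPart (m * F) = m * fifthPart F := fun m F ↦ by
    rw [← nsmul_eq_mul, map_nsmul, nsmul_eq_mul]
  have hUU : fifthPart (fifthPart (X ^ 4 * c ^ 4)) = (3125 : ℕ) * (-20 * (f ^ 2 * k' * v ^ 3) -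
      22 * (f ^ 8 * k' ^ 2 * v ^ 2) + fifthPart (4 * (f ^ 2 * X ^ 3 * k ^ 14) +
        25 * (f' ^ 4 * X ^ 4 * k ^ 20))) := by
    have := congrArg fifthPart hUD
    rw [map_add, map_add] at this
    have h1 := hmul 4 (X * f ^ 14 * k ^ 2)
    have h2 := hmul 550 (X ^ 2 * f ^ 8 * k ^ 8)
    have h3 := hmul 3125 (4 * (f ^ 2 * X ^ 3 * k ^ 14) + 25 * (f' ^ 4 * X ^ 4 * k ^ 20))
    push_cast at h1 h2 h3 ⊢
    rw [h1, h2, h3, u14, u8] at this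
    rw [this]
    ring
  have hfin := congrArg (coeff (n + 1)) hUU
  rw [coeff_fifthPart, coeff_fifthPart, ← nsmul_eq_mul, map_nsmul, nsmul_eq_mul,
    show 5 * (5 * (n + 1)) = 25 * n + 21 + 4 by ring, coeff_X_pow_mul] at hfin
  exact ⟨_, hfin⟩

end FiveCore

namespace FiveCore

open Finset

theorem lt_getD_iff {l : List ℕ} (hl : l.Pairwise (· ≥ ·)) (i j : ℕ) :
    j < l.getD i 0 ↔ i < l.countP (j < ·) := by
  induction l generalizing i with
  | nil => simp
  | cons a t ih =>
    rw [List.pairwise_cons] at hl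
    by_cases hja : j < a
    · rw [List.countP_cons_of_pos (by simpa using hja)]
      cases i with
      | zero => simpa using hja
      | succ i => simpa using ih hl.2 i
    · have h0 : (a :: t).countP (j < ·) = 0 := by
        rw [List.countP_eq_zero]
        intro x hx
        rcases List.mem_cons.1 hx with rfl | hx
        · simpa using hja
        · have := hl.1 x hx
          simp only [decide_eq_true_eq]
          omega
      rw [h0]
      have h1 : (a :: t).getD i 0 ≤ a := by
        cases i with
        | zero => simp
        | succ i =>
          rw [List.getD_cons_succ]
          by_cases hi : i < t.length
          · rw [List.getD_eq_getElem _ _ hi]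
            exact hl.1 _ (List.getElem_mem hi)
          · rw [List.getD_eq_default _ _ (by omega)]
            omega
      omega

/-- The length of the `i`-th row of a partition. -/
def rowLength {n : ℕ} (p : n.Partition) (i : ℕ) : ℕ :=
  (p.parts.sort (· ≤ ·)).reverse.getD i 0

theorem lt_rowLength_iff {n : ℕ} (p : n.Partition) (i j : ℕ) :
    j < rowLength p i ↔ i < (p.parts.filter (j < ·)).card := by
  have hl : ((p.parts.sort (· ≤ ·)).reverse).Pairwise (· ≥ ·) := by
    rw [List.pairwise_reverse]
    exact Multiset.pairwise_sort _ _
  rw [rowLength, lt_getD_iff hl, ← Multiset.countP_eq_card_filter]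
  conv_rhs => rw [← Multiset.sort_eq p.parts (· ≤ ·), ← Multiset.coe_reverse, Multiset.coe_countP]

theorem rowLength_antitone {n : ℕ} (p : n.Partition) : Antitone (rowLength p) := by
  intro i i' h
  by_contra! hlt
  have h1 := (lt_rowLength_iff p i' (rowLength p i)).1 hlt
  exact lt_irrefl _ ((lt_rowLength_iff p i (rowLength p i)).2 (h.trans_lt h1))

theorem card_filter_parts_le {n : ℕ} (p : n.Partition) (j : ℕ) :
    (p.parts.filter (j < ·)).card ≤ n := by
  calc (p.parts.filter (j < ·)).card ≤ p.parts.card :=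
        Multiset.card_le_card (Multiset.filter_le _ _)
    _ = p.parts.card • 1 := by simp
    _ ≤ p.parts.sum := Multiset.card_nsmul_le_sum fun x hx ↦ p.parts_pos hx
    _ = n := p.parts_sum

theorem multiset_ext_of_card_filter {s t : Multiset ℕ} (hs : ∀ x ∈ s, 0 < x) (ht : ∀ x ∈ t, 0 < x)
    (h : ∀ j, (s.filter (j < ·)).card = (t.filter (j < ·)).card) : s = t := by
  have key : ∀ (u : Multiset ℕ) (a : ℕ), (u.filter (a < ·)).card =
      (u.filter (a + 1 < ·)).card + u.count (a + 1) := by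
    intro u a
    rw [← Multiset.countP_eq_card_filter, ← Multiset.countP_eq_card_filter]
    induction u using Multiset.induction_on with
    | empty => simp
    | cons x u ih =>
      rw [Multiset.countP_cons, Multiset.countP_cons, Multiset.count_cons, ih]
      split_ifs <;> omega
  ext a
  cases a with
  | zero =>
    rw [Multiset.count_eq_zero_of_notMem fun h0 ↦ lt_irrefl _ (hs 0 h0),
      Multiset.count_eq_zero_of_notMem fun h0 ↦ lt_irrefl _ (ht 0 h0)]
  | succ a =>
    have := key s a
    have := key t a
    have := h a
    have := h (a + 1)
    omega

section Count

variable (Y : Finset ℕ)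

theorem count_mem_add_count_notMem (x : ℕ) :
    Nat.count (· ∈ Y) x + Nat.count (· ∉ Y) x = x := by
  induction x with
  | zero => simp
  | succ x ih =>
    rw [Nat.count_succ, Nat.count_succ]
    split_ifs <;> omega

theorem image_count_mem : Y.image (Nat.count (· ∈ Y)) = range #Y := by
  refine Finset.eq_of_subset_of_card_le ?_ ?_
  · intro i hi
    obtain ⟨x, hx, rfl⟩ := mem_image.1 hi
    rw [mem_range, Nat.count_eq_card_filter_range]
    refine card_lt_card ((ssubset_iff_of_subset fun y hy ↦ (mem_filter.1 hy).2).2 ⟨x, hx, ?_⟩)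
    simp
  · rw [card_range, card_image_of_injOn fun x hx y hy h ↦
      Nat.count_injective (p := (· ∈ Y)) hx hy h]

theorem sum_eq_choose_add :
    ∑ x ∈ Y, x = (#Y).choose 2 + ∑ x ∈ Y, Nat.count (· ∉ Y) x := by
  have h1 : ∑ x ∈ Y, Nat.count (· ∈ Y) x = (#Y).choose 2 := by
    rw [Nat.choose_two_right, ← sum_range_id, ← image_count_mem Y,
      sum_image fun x hx y hy h ↦ Nat.count_injective (p := (· ∈ Y)) hx hy h]
  rw [← h1, ← sum_add_distrib]
  exact sum_congr rfl fun x _ ↦ (count_mem_add_count_notMem Y x).symm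

theorem choose_add_le_sum {u : ℕ} (hu : u ∉ Y) : (#Y).choose 2 + #Y ≤ ∑ x ∈ Y, x + u := by
  have h1 : #(Y.filter (u < ·)) ≤ ∑ x ∈ Y, Nat.count (· ∉ Y) x := by
    rw [card_filter]
    refine sum_le_sum fun x _ ↦ ?_
    split_ifs with h
    · exact Nat.one_le_iff_ne_zero.2 (Nat.count_ne_iff_exists.2 ⟨u, h, hu⟩)
    · exact Nat.zero_le _
  have h2 : #Y ≤ #(Y.filter (u < ·)) + u := by
    rw [← card_filter_add_card_filter_not (s := Y) (u < ·)]
    gcongr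
    calc #(Y.filter fun x ↦ ¬ u < x) ≤ #(range u) := by
          refine card_le_card fun x hx ↦ ?_
          rw [mem_filter] at hx
          rw [mem_range]
          have : x ≠ u := by
            rintro rfl
            exact hu hx.1
          omega
      _ = u := card_range u
  have := sum_eq_choose_add Y
  omega

end Count

/-- `Y` is a set of beta numbers (first column hook lengths, possibly shifted) of `p`. -/
def IsBetaSet {n : ℕ} (p : n.Partition) (Y : Finset ℕ) : Prop :=
  ∀ a, (p.parts.filter (a < ·)).card = #(Y.filter fun x ↦ a < Nat.count (· ∉ Y) x)

theorem card_filter_lt (Y : Finset ℕ) (x : ℕ) (hx : x ∈ Y) :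
    #(Y.filter (x < ·)) + Nat.count (· ∈ Y) x + 1 = #Y := by
  rw [← card_filter_add_card_filter_not (s := Y) (x < ·), add_assoc]
  congr 1
  rw [← (Nat.count_succ_eq_succ_count_iff (p := (· ∈ Y))).2 hx, Nat.count_eq_card_filter_range]
  congr 1
  ext y
  simp only [mem_filter, mem_range]
  constructor
  · rintro ⟨h1, h2⟩
    exact ⟨h2, by omega⟩
  · rintro ⟨h1, h2⟩
    exact ⟨by omega, h1⟩

namespace IsBetaSet

variable {n : ℕ} {p q : n.Partition} {Y Z : Finset ℕ}

theorem rowLength_eq (h : IsBetaSet p Y) {x : ℕ} (hx : x ∈ Y) :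
    rowLength p #(Y.filter (x < ·)) = Nat.count (· ∉ Y) x := by
  refine eq_of_forall_lt_iff fun j ↦ ?_
  rw [lt_rowLength_iff, h j]
  constructor
  · intro hlt
    by_contra hj
    refine absurd hlt (not_lt.2 (card_le_card fun y hy ↦ ?_))
    rw [mem_filter] at hy ⊢
    refine ⟨hy.1, ?_⟩
    by_contra hxy
    have := Nat.count_monotone (· ∉ Y) (not_lt.1 hxy)
    omega
  · intro hj
    refine card_lt_card ((ssubset_iff_of_subset fun y hy ↦ ?_).2 ⟨x, ?_, ?_⟩)
    · rw [mem_filter] at hy ⊢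
      exact ⟨hy.1, hj.trans_le (Nat.count_monotone _ hy.2.le)⟩
    · exact mem_filter.2 ⟨hx, hj⟩
    · simp

theorem eq_image (h : IsBetaSet p Y) :
    Y = (range #Y).image fun i ↦ rowLength p i + (#Y - 1 - i) := by
  refine Finset.eq_of_subset_of_card_le ?_ (card_image_le.trans (card_range _).le)
  intro x hx
  have h1 := card_filter_lt Y x hx
  refine mem_image.2 ⟨#(Y.filter (x < ·)), mem_range.2 (by omega), ?_⟩
  rw [h.rowLength_eq hx]
  have := count_mem_add_count_notMem Y x
  omega

theorem right_unique (h : IsBetaSet p Y) (h' : IsBetaSet p Z) (hc : #Y = #Z) : Y = Z := by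
  rw [h.eq_image, h'.eq_image, hc]

theorem left_unique (h : IsBetaSet p Y) (h' : IsBetaSet q Y) : p = q :=
  Nat.Partition.ext (multiset_ext_of_card_filter (fun _ ↦ p.parts_pos) (fun _ ↦ q.parts_pos)
    fun j ↦ (h j).trans (h' j).symm)

theorem parts_eq (h : IsBetaSet p Y) :
    p.parts = (Y.val.map (Nat.count (· ∉ Y))).filter (0 < ·) := by
  refine multiset_ext_of_card_filter (fun _ ↦ p.parts_pos) (by simp) fun j ↦ ?_
  rw [h j, Multiset.filter_filter, Multiset.filter_map, Multiset.card_map, card_def, filter_val]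
  congr 2
  ext x
  simp only [Function.comp]
  omega

theorem sum_eq (h : IsBetaSet p Y) : ∑ x ∈ Y, x = (#Y).choose 2 + n := by
  rw [sum_eq_choose_add]
  congr 1
  rw [← p.parts_sum, h.parts_eq]
  simp only [pos_iff_ne_zero]
  exact (Nat.Partition.ofSums _ (Y.val.map (Nat.count (· ∉ Y))) rfl).parts_sum.symm

end IsBetaSet

theorem exists_partition_isBetaSet {n : ℕ} {Y : Finset ℕ} (h : ∑ x ∈ Y, x = (#Y).choose 2 + n) :
    ∃ p : n.Partition, IsBetaSet p Y := by
  have h1 : (Y.val.map (Nat.count (· ∉ Y))).sum = n := by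
    have := sum_eq_choose_add Y
    rw [h] at this
    exact (Nat.add_left_cancel this).symm
  refine ⟨Nat.Partition.ofSums n _ h1, fun a ↦ ?_⟩
  rw [Nat.Partition.ofSums, Multiset.filter_filter, Multiset.filter_map, Multiset.card_map,
    card_def, filter_val]
  congr 2
  ext x
  simp only [Function.comp]
  omega

theorem exists_isBetaSet {n N : ℕ} (p : n.Partition) (hN : n ≤ N) :
    ∃ Y : Finset ℕ, #Y = N ∧ IsBetaSet p Y := by
  have hanti := rowLength_antitone p
  set b : ℕ → ℕ := fun i ↦ rowLength p i + (N - 1 - i)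
  have hb : ∀ i < N, ∀ i' < N, b i < b i' ↔ i' < i := by
    intro i hi i' hi'
    rcases lt_trichotomy i i' with hlt | rfl | hlt
    · have := hanti hlt.le
      simp only [b]
      omega
    · simp
    · have := hanti hlt.le
      simp only [b]
      omega
  have hinj : Set.InjOn b (range N) := by
    intro i hi i' hi' h
    rw [mem_coe, mem_range] at hi hi'
    have h1 := hb i hi i' hi'
    have h2 := hb i' hi' i hi
    omega
  have hcard : #((range N).image b) = N := by rw [card_image_of_injOn hinj, card_range]
  refine ⟨(range N).image b, hcard, fun a ↦ ?_⟩
  have hcount : ∀ i ∈ range N, Nat.count (· ∉ (range N).image b) (b i) = rowLength p i := by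
    intro i hi
    rw [mem_range] at hi
    have h1 := card_filter_lt _ _ (mem_image_of_mem b (mem_range.2 hi))
    have h2 := count_mem_add_count_notMem ((range N).image b) (b i)
    have h3 : #(((range N).image b).filter (b i < ·)) = i := by
      rw [filter_image, card_image_of_injOn (hinj.mono (coe_subset.2 (filter_subset _ _)))]
      conv_rhs => rw [← card_range i]
      congr 1
      ext i'
      simp only [mem_filter, mem_range]
      constructor
      · rintro ⟨h, h'⟩
        exact (hb i hi i' h).1 h'
      · intro h
        exact ⟨h.trans hi, (hb i hi i' (h.trans hi)).2 h⟩
    rw [hcard] at h1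
    simp only [b] at h1 h2 h3 ⊢
    omega
  have h4 := card_filter_parts_le p a
  rw [filter_image, card_image_of_injOn (hinj.mono (coe_subset.2 (filter_subset _ _))),
    filter_congr fun i hi ↦ by
    rw [hcount i hi, lt_rowLength_iff]]
  conv_lhs => rw [← card_range (p.parts.filter (a < ·)).card]
  congr 1
  ext i
  simp only [mem_filter, mem_range]
  omega

theorem IsBetaSet.isTCore_iff {n t : ℕ} {p : n.Partition} {Y : Finset ℕ} (h : IsBetaSet p Y) :
    IsTCore t p ↔ ∀ x ∈ Y, ∀ u ∉ Y, u < x → ¬ t ∣ x - u := by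
  have key : ∀ x ∈ Y, ∀ u ∉ Y, u < x →
      hookLength p #(Y.filter (x < ·)) (Nat.count (· ∉ Y) u) = x - u := by
    intro x hx u hu hux
    have h1 : (p.parts.filter (Nat.count (· ∉ Y) u < ·)).card = #(Y.filter (u < ·)) := by
      rw [h]
      congr 1
      refine filter_congr fun y hy ↦ ⟨fun hlt ↦ ?_, fun hlt ↦ Nat.count_strict_mono hu hlt⟩
      exact Nat.lt_of_count_lt_count hlt
    have h2 := h.rowLength_eq hx
    rw [rowLength] at h2
    rw [hookLength, h1, h2]
    have h3 := card_filter_lt Y x hx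
    have h4 : #(Y.filter (u < ·)) + Nat.count (· ∈ Y) u = #Y := by
      rw [← card_filter_add_card_filter_not (s := Y) (u < ·)]
      congr 1
      rw [Nat.count_eq_card_filter_range]
      congr 1
      ext y
      simp only [mem_filter, mem_range, not_lt]
      refine ⟨fun hy ↦ ⟨hy.2, hy.1.le⟩, fun hy ↦ ⟨lt_of_le_of_ne hy.2 ?_, hy.1⟩⟩
      rintro rfl
      exact hu hy.1
    have h5 := count_mem_add_count_notMem Y x
    have h6 := count_mem_add_count_notMem Y u
    have h7 := Nat.count_strict_mono (p := (· ∉ Y)) hu hux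
    have h8 := Nat.count_monotone (· ∈ Y) hux.le
    omega
  constructor
  · intro hc x hx u hu hux
    rw [← key x hx u hu hux]
    apply hc
    have h2 := h.rowLength_eq hx
    rw [rowLength] at h2
    rw [h2]
    exact Nat.count_strict_mono (p := (· ∉ Y)) hu hux
  · intro hc i j hj
    have hinf : (Set.ofPred (· ∉ Y)).Infinite := Y.finite_toSet.infinite_compl
    have hlt := (lt_rowLength_iff p i j).1 hj
    have hi : i < #Y := by
      rw [h] at hlt
      exact hlt.trans_le (card_filter_le _ _)
    obtain ⟨x, hx, hxi⟩ := mem_image.1 ((image_count_mem Y).symm ▸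
      mem_range.2 (by omega : #Y - 1 - i < #Y))
    have h3 := card_filter_lt Y x hx
    obtain rfl : i = #(Y.filter (x < ·)) := by omega
    have hu : Nat.nth (· ∉ Y) j ∉ Y := Nat.nth_mem_of_infinite hinf j
    have hju := Nat.count_nth_of_infinite (p := (· ∉ Y)) hinf j
    have h2 := h.rowLength_eq hx
    rw [rowLength] at h2
    rw [h2] at hj
    have hux : Nat.nth (· ∉ Y) j < x := Nat.nth_lt_of_lt_count hj
    have := key x hx _ hu hux
    rw [hju] at this
    rw [this]
    exact hc x hx _ hu hux

end FiveCore

namespace FiveCore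

open Finset

/-- The set of beta numbers having `ν r` beads, pushed to the start, on the `r`-th runner of the
abacus with five runners. -/
def abacus (ν : Fin 5 → ℕ) : Finset ℕ :=
  (univ.sigma fun r ↦ range (ν r)).image fun s ↦ 5 * s.2 + s.1

theorem sum_abacus (ν : Fin 5 → ℕ) (g : ℕ → ℕ) :
    ∑ x ∈ abacus ν, g x = ∑ r, ∑ k ∈ range (ν r), g (5 * k + r) := by
  rw [abacus, sum_image, sum_sigma]
  rintro ⟨r, k⟩ - ⟨r', k'⟩ - h
  dsimp only at h
  obtain rfl : r = r' := Fin.ext (by omega)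
  obtain rfl : k = k' := by omega
  rfl

theorem mem_abacus {ν : Fin 5 → ℕ} {k : ℕ} {r : Fin 5} :
    5 * k + (r : ℕ) ∈ abacus ν ↔ k < ν r := by
  simp only [abacus, mem_image, mem_sigma, mem_univ, true_and, mem_range, Sigma.exists]
  constructor
  · rintro ⟨r', k', hk, h⟩
    obtain rfl : r' = r := Fin.ext (by omega)
    obtain rfl : k' = k := by omega
    exact hk
  · exact fun h ↦ ⟨r, k, h, rfl⟩

theorem card_abacus (ν : Fin 5 → ℕ) : #(abacus ν) = ∑ r, ν r := by
  rw [card_eq_sum_ones, sum_abacus ν fun _ ↦ 1]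
  simp

/-- The sum of the elements of the abacus configuration `ν`. -/
def weight (ν : Fin 5 → ℕ) : ℕ :=
  ∑ r : Fin 5, (r * ν r + 5 * (ν r).choose 2)

theorem sum_abacus_id (ν : Fin 5 → ℕ) : ∑ x ∈ abacus ν, x = weight ν := by
  rw [sum_abacus ν fun x ↦ x, weight]
  refine sum_congr rfl fun r _ ↦ ?_
  rw [sum_add_distrib, ← mul_sum, sum_range_id, ← Nat.choose_two_right, sum_const, card_range,
    smul_eq_mul]
  ring

theorem exists_eq_five_mul_add (x : ℕ) : ∃ (k : ℕ) (r : Fin 5), x = 5 * k + r :=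
  ⟨x / 5, ⟨x % 5, Nat.mod_lt _ (by norm_num)⟩, (Nat.div_add_mod x 5).symm⟩

theorem abacus_closed (ν : Fin 5 → ℕ) :
    ∀ x ∈ abacus ν, ∀ u ∉ abacus ν, u < x → ¬ 5 ∣ x - u := by
  intro x hx u hu hux hdvd
  obtain ⟨k, r, rfl⟩ := exists_eq_five_mul_add x
  obtain ⟨k', r', rfl⟩ := exists_eq_five_mul_add u
  obtain rfl : r' = r := Fin.ext (by omega)
  rw [mem_abacus] at hx hu
  omega

theorem exists_abacus_eq {Y : Finset ℕ} (h : ∀ x ∈ Y, ∀ u ∉ Y, u < x → ¬ 5 ∣ x - u) :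
    ∃ ν, abacus ν = Y := by
  have hex : ∀ r : Fin 5, ∃ k, 5 * k + (r : ℕ) ∉ Y := by
    intro r
    by_contra! hall
    exact Set.infinite_of_injective_forall_mem (f := fun k ↦ 5 * k + (r : ℕ))
      (fun a b hab ↦ by dsimp only at hab; omega) hall Y.finite_toSet
  classical
  refine ⟨fun r ↦ Nat.find (hex r), ?_⟩
  ext x
  obtain ⟨k, r, rfl⟩ := exists_eq_five_mul_add x
  rw [mem_abacus]
  constructor
  · intro hk
    exact not_not.1 (Nat.find_min (hex r) hk)
  · intro hk
    by_contra hle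
    have hne : 5 * Nat.find (hex r) + (r : ℕ) ≠ 5 * k + r := fun heq ↦
      Nat.find_spec (hex r) (heq ▸ hk)
    exact h _ hk _ (Nat.find_spec (hex r)) (by omega) ⟨k - Nat.find (hex r), by omega⟩

theorem abacus_injective : Function.Injective abacus := by
  intro ν ν' h
  funext r
  refine eq_of_forall_lt_iff fun k ↦ ?_
  rw [← mem_abacus, ← mem_abacus, h]

variable {N n : ℕ} {ν : Fin 5 →₀ ℕ}

theorem card_abacus_of_mem (hν : ν ∈ finsuppAntidiag univ N) : #(abacus ν) = N := by
  rw [card_abacus]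
  exact (mem_finsuppAntidiag.1 hν).1

theorem choose_le_weight (hν : ν ∈ finsuppAntidiag univ N) : N.choose 2 ≤ weight ν := by
  rw [← sum_abacus_id, sum_eq_choose_add, card_abacus_of_mem hν]
  exact Nat.le_add_right _ _

theorem le_of_weight_le (hν : ν ∈ finsuppAntidiag univ N) (hw : weight ν ≤ N.choose 2 + n)
    (hn : 6 * n ≤ N) (r : Fin 5) : n ≤ ν r := by
  have h1 := choose_add_le_sum (abacus ν) (mem_abacus.not.2 (lt_irrefl (ν r)))
  rw [card_abacus_of_mem hν, sum_abacus_id] at h1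
  omega

/-- The number of `t`-cores of `n`. -/
noncomputable def coreCount (t n : ℕ) : ℕ :=
  Nat.card {p : n.Partition // IsTCore t p}

theorem coreCount_five_eq (h : n ≤ N) :
    coreCount 5 n = #((finsuppAntidiag univ N : Finset (Fin 5 →₀ ℕ)).filter fun ν : Fin 5 →₀ ℕ ↦
      weight ν = N.choose 2 + n) := by
  set S := (finsuppAntidiag univ N : Finset (Fin 5 →₀ ℕ)).filter fun ν : Fin 5 →₀ ℕ ↦
    weight ν = N.choose 2 + n
  have hS : ∀ ν ∈ S, ∃ p : n.Partition, IsBetaSet p (abacus ν) := by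
    intro ν hν
    obtain ⟨h1, h2⟩ := mem_filter.1 hν
    apply exists_partition_isBetaSet
    rw [sum_abacus_id, card_abacus_of_mem h1, h2]
  choose f hf using hS
  rw [coreCount, ← Fintype.card_coe S, ← Nat.card_eq_fintype_card, eq_comm]
  refine Nat.card_congr (Equiv.ofBijective (fun ν : S ↦ ⟨f ν.1 ν.2,
    (hf ν.1 ν.2).isTCore_iff.2 (abacus_closed _)⟩) ⟨?_, ?_⟩)
  · rintro ⟨ν, hν⟩ ⟨ν', hν'⟩ heq
    simp only [Subtype.mk.injEq] at heq
    have h1 := card_abacus_of_mem (mem_filter.1 hν).1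
    have h2 := card_abacus_of_mem (mem_filter.1 hν').1
    have h3 := hf ν' hν'
    rw [← heq] at h3
    exact Subtype.ext (DFunLike.coe_injective (abacus_injective
      ((hf ν hν).right_unique h3 (h1.trans h2.symm))))
  · rintro ⟨p, hp⟩
    obtain ⟨Y, hY, hpY⟩ := exists_isBetaSet p h
    obtain ⟨ν, rfl⟩ := exists_abacus_eq (hpY.isTCore_iff.1 hp)
    have hmem : Finsupp.equivFunOnFinite.symm ν ∈ S := by
      refine mem_filter.2 ⟨mem_finsuppAntidiag.2 ⟨?_, subset_univ _⟩, ?_⟩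
      · rw [← hY, card_abacus]
        rfl
      · rw [← hY, ← hpY.sum_eq, sum_abacus_id]
        rfl
    exact ⟨⟨_, hmem⟩, Subtype.ext ((hf _ hmem).left_unique hpY)⟩

end FiveCore

namespace FiveCore

open PowerSeries Finset

section QBinomial

variable {R : Type*} [CommRing R] (q : R)

/-- The finite product `∏ (1 + qⁱ z)` over `i < K`, as a power series in `z`. -/
noncomputable def qProd (K : ℕ) : R⟦X⟧ := ∏ i ∈ range K, (1 + C (q ^ i) * X)

theorem qProd_succ (K : ℕ) : qProd q (K + 1) = qProd q K + C (q ^ K) * (qProd q K * X) := by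
  rw [qProd, prod_range_succ, ← qProd]
  ring

theorem prod_rescale (c : R) (K : ℕ) :
    ∏ i ∈ range K, (1 + C (c * q ^ i) * X) = rescale c (qProd q K) := by
  rw [qProd, map_prod]
  refine prod_congr rfl fun i _ ↦ ?_
  rw [map_add, map_mul (rescale c), rescale_X, map_one, map_mul]
  have : rescale c (C (q ^ i)) = C (q ^ i) := by
    ext n
    rw [coeff_rescale, coeff_C]
    split_ifs with h <;> simp [h]
  rw [this]
  ring

theorem qProd_succ_left (K : ℕ) :
    qProd q (K + 1) = rescale q (qProd q K) + rescale q (qProd q K) * X := by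
  rw [qProd, prod_range_succ', ← prod_rescale]
  simp only [pow_succ', pow_zero, map_one, one_mul]
  ring

theorem one_sub_mul_coeff_qProd (N K : ℕ) :
    (1 - q ^ (N + 1)) * coeff (N + 1) (qProd q K) = (q ^ N - q ^ K) * coeff N (qProd q K) := by
  have h1 := congrArg (coeff (N + 1)) (qProd_succ q K)
  have h2 := congrArg (coeff (N + 1)) (qProd_succ_left q K)
  rw [map_add, coeff_C_mul, coeff_succ_mul_X] at h1
  rw [map_add, coeff_succ_mul_X, coeff_rescale, coeff_rescale] at h2
  linear_combination h2 - h1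

theorem prod_mul_coeff_qProd {N K : ℕ} (h : N ≤ K) :
    (∏ i ∈ range N, (1 - q ^ (i + 1))) * coeff N (qProd q K) =
      q ^ N.choose 2 * ∏ i ∈ range N, (1 - q ^ (K - i)) := by
  induction N with
  | zero => simp [qProd, map_prod]
  | succ N ih =>
    have h1 := one_sub_mul_coeff_qProd q N K
    have h2 : q ^ K = q ^ N * q ^ (K - N) := by rw [← pow_add, Nat.add_sub_cancel' (by omega)]
    rw [prod_range_succ, prod_range_succ, Nat.choose_succ_succ' N 1, Nat.choose_one_right, pow_add]
    rw [h2] at h1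
    linear_combination (∏ i ∈ range N, (1 - q ^ (i + 1))) * h1 +
      q ^ N * (1 - q ^ (K - N)) * ih (by omega)

theorem prod_range_five_mul {M : Type*} [CommMonoid M] (a : ℕ → M) (K : ℕ) :
    ∏ i ∈ range (5 * K), a i = ∏ r : Fin 5, ∏ k ∈ range K, a (5 * k + r) := by
  induction K with
  | zero => simp
  | succ K ih =>
    simp_rw [prod_range_succ _ K, prod_mul_distrib, ← ih, Fin.prod_univ_five, mul_add,
      prod_range_succ, mul_assoc]
    rfl

theorem coeff_qProd_five_mul (N K : ℕ) :
    coeff N (qProd q (5 * K)) = ∑ ν ∈ (finsuppAntidiag univ N : Finset (Fin 5 →₀ ℕ)),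
      ∏ r : Fin 5, (q ^ (r * ν r : ℕ) * coeff (ν r) (qProd (q ^ 5) K)) := by
  have : qProd q (5 * K) = ∏ r : Fin 5, rescale (q ^ (r : ℕ)) (qProd (q ^ 5) K) := by
    rw [qProd, prod_range_five_mul]
    refine prod_congr rfl fun r _ ↦ ?_
    rw [← prod_rescale]
    refine prod_congr rfl fun k _ ↦ ?_
    rw [← pow_mul, ← pow_add, add_comm (5 * k)]
  rw [this, coeff_prod]
  refine sum_congr rfl fun ν _ ↦ prod_congr rfl fun r _ ↦ ?_
  rw [coeff_rescale, pow_mul]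

theorem map_coeff_qProd {S : Type*} [CommRing S] (φ : R →+* S) (N K : ℕ) :
    φ (coeff N (qProd q K)) = coeff N (qProd (φ q) K) := by
  rw [← coeff_map, qProd, qProd, map_prod]
  simp

end QBinomial

theorem X_pow_dvd_prod_sub_one {ι : Type*} (s : Finset ι) (e : ι → ℕ) {m : ℕ}
    (h : ∀ i ∈ s, m ≤ e i) : (X : ℤ⟦X⟧) ^ m ∣ ∏ i ∈ s, (1 - X ^ e i) - 1 := by
  classical
  induction s using Finset.induction_on with
  | empty => simp
  | insert a s ha ih =>
    rw [prod_insert ha]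
    have h1 := ih fun i hi ↦ h i (mem_insert_of_mem hi)
    have h2 := pow_dvd_pow (X : ℤ⟦X⟧) (h a (mem_insert_self a s))
    convert h1.sub (h2.mul_right (∏ i ∈ s, (1 - X ^ e i))) using 1
    ring

theorem X_pow_dvd_pentagonalSeries_sub (N : ℕ) :
    X ^ (N + 1) ∣ pentagonalSeries ℤ - ∏ i ∈ range N, (1 - X ^ (i + 1)) := by
  rw [X_pow_dvd_iff]
  intro m hm
  obtain ⟨s, hs, hsN⟩ := ((coeff_prod_one_sub_X_pow_eventually_eq ℤ m).and
    (Filter.eventually_ge_atTop (range N))).exists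
  have h1 := X_pow_dvd_prod_sub_one (s \ range N) (fun i ↦ i + 1) (m := N + 1) (by
    intro i hi
    simp only [mem_sdiff, mem_range] at hi
    omega)
  have h2 := X_pow_dvd_iff.1 (h1.mul_right (∏ i ∈ range N, (1 - X ^ (i + 1)))) m hm
  rw [sub_mul, prod_sdiff hsN, one_mul, map_sub] at h2
  rw [map_sub, ← hs, h2]

theorem isUnit_prod_one_sub_X_pow (N : ℕ) :
    IsUnit (∏ i ∈ range N, (1 - X ^ (i + 1)) : ℤ⟦X⟧) := by
  rw [isUnit_iff_constantCoeff, map_prod]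
  simp

theorem X_pow_dvd_coeff_qProd {N K : ℕ} (h : N ≤ K) :
    X ^ N.choose 2 ∣ coeff N (qProd (X : ℤ⟦X⟧) K) :=
  (isUnit_prod_one_sub_X_pow N).dvd_mul_left.1
    ((prod_mul_coeff_qProd (X : ℤ⟦X⟧) h).symm ▸ dvd_mul_right _ _)

theorem exists_pentagonalSeries_mul_coeff_qProd {n N K : ℕ} (hN : n ≤ N) (hK : N + n ≤ K) :
    ∃ g : ℤ⟦X⟧, pentagonalSeries ℤ * coeff N (qProd X K) =
      X ^ N.choose 2 * (1 + X ^ (n + 1) * g) := by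
  obtain ⟨a, ha⟩ := (pow_dvd_pow (X : ℤ⟦X⟧) (by omega : n + 1 ≤ N + 1)).trans
    (X_pow_dvd_pentagonalSeries_sub N)
  obtain ⟨b, hb⟩ := X_pow_dvd_prod_sub_one (range N) (fun i ↦ K - i) (m := n + 1) (by
    intro i hi
    rw [mem_range] at hi
    omega)
  obtain ⟨d, hd⟩ := X_pow_dvd_coeff_qProd (by omega : N ≤ K)
  have h := prod_mul_coeff_qProd (X : ℤ⟦X⟧) (by omega : N ≤ K)
  refine ⟨a * d + b, ?_⟩
  linear_combination h + coeff N (qProd X K) * ha + X ^ (n + 1) * a * hd +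
    X ^ N.choose 2 * hb

/-- The generating function of the number of `5`-cores. -/
noncomputable def coreSeries : ℤ⟦X⟧ := mk fun n ↦ (coreCount 5 n : ℤ)

theorem prod_X_pow_eq (ν : Fin 5 → ℕ) :
    ∏ r : Fin 5, ((X : ℤ⟦X⟧) ^ (r * ν r : ℕ) * X ^ (5 * (ν r).choose 2)) = X ^ weight ν := by
  simp_rw [← pow_add, prod_pow_eq_pow_sum, weight]

/-- The contribution of the abacus configuration `ν` to the coefficient of `z ^ N` in the
finite product `∏ (1 + X ^ i * z)` over `i < 5 * K`. -/
noncomputable def abacusTerm (K : ℕ) (ν : Fin 5 → ℕ) : ℤ⟦X⟧ :=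
  ∏ r : Fin 5, (X ^ (r * ν r : ℕ) * coeff (ν r) (qProd (X ^ 5) K))

theorem coeff_qProd_X_pow_five (m K : ℕ) :
    coeff m (qProd ((X : ℤ⟦X⟧) ^ 5) K) = expand 5 (by norm_num) (coeff m (qProd X K)) := by
  have := map_coeff_qProd (X : ℤ⟦X⟧) (expand 5 (by norm_num) : ℤ⟦X⟧ →ₐ[ℤ] ℤ⟦X⟧).toRingHom m K
  simpa using this.symm

theorem X_pow_weight_dvd_abacusTerm {K : ℕ} {ν : Fin 5 → ℕ} (h : ∀ r, ν r ≤ K) :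
    X ^ weight ν ∣ abacusTerm K ν := by
  rw [← prod_X_pow_eq, abacusTerm]
  refine prod_dvd_prod_of_dvd _ _ fun r _ ↦ mul_dvd_mul_left _ ?_
  have := map_dvd (expand 5 (by norm_num) : ℤ⟦X⟧ →ₐ[ℤ] ℤ⟦X⟧) (X_pow_dvd_coeff_qProd (h r))
  rwa [map_pow, expand_X, ← pow_mul, ← coeff_qProd_X_pow_five] at this

theorem exists_pow_five_mul_abacusTerm {n K : ℕ} {ν : Fin 5 → ℕ} (h : ∀ r, n ≤ ν r)
    (hK : ∀ r, ν r + n ≤ K) :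
    ∃ g : ℤ⟦X⟧, expand 5 (by norm_num) (pentagonalSeries ℤ) ^ 5 * abacusTerm K ν =
      X ^ weight ν * (1 + X ^ (n + 1) * g) := by
  have hr : ∀ r, ∃ g : ℤ⟦X⟧, expand 5 (by norm_num) (pentagonalSeries ℤ) *
      coeff (ν r) (qProd (X ^ 5) K) = X ^ (5 * (ν r).choose 2) * (1 + X ^ (n + 1) * g) := by
    intro r
    obtain ⟨g, hg⟩ := exists_pentagonalSeries_mul_coeff_qProd (h r) (hK r)
    refine ⟨X ^ (4 * (n + 1)) * expand 5 (by norm_num) g, ?_⟩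
    have := congrArg (expand 5 (by norm_num)) hg
    simp only [map_mul, map_add, map_one, map_pow, expand_X, ← pow_mul] at this
    rw [coeff_qProd_X_pow_five, this]
    ring
  choose g hg using hr
  have hprod : ∀ s : Finset (Fin 5), ∃ b, ∏ r ∈ s, (1 + X ^ (n + 1) * g r) =
      1 + X ^ (n + 1) * b := by
    intro s
    induction s using Finset.induction_on with
    | empty => exact ⟨0, by simp⟩
    | insert a s ha ih =>
      obtain ⟨b, hb⟩ := ih
      refine ⟨g a + b + X ^ (n + 1) * g a * b, ?_⟩
      rw [prod_insert ha, hb]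
      ring
  obtain ⟨b, hb⟩ := hprod univ
  refine ⟨b, ?_⟩
  rw [← hb, ← prod_X_pow_eq, ← prod_mul_distrib, abacusTerm,
    show expand 5 (by norm_num) (pentagonalSeries ℤ) ^ 5 =
      ∏ _r : Fin 5, expand 5 (by norm_num) (pentagonalSeries ℤ) by simp, ← prod_mul_distrib]
  refine prod_congr rfl fun r _ ↦ ?_
  rw [mul_left_comm, hg, mul_assoc]

theorem coeff_mul_abacusTerm {n N : ℕ} {ν : Fin 5 →₀ ℕ} (hN : N = 6 * n)
    (hν : ν ∈ finsuppAntidiag univ N) :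
    coeff (N.choose 2 + n) (pentagonalSeries ℤ *
      (expand 5 (by norm_num) (pentagonalSeries ℤ) ^ 5 * abacusTerm (7 * n) ν)) =
    if weight ν ≤ N.choose 2 + n then
      coeff (N.choose 2 + n - weight ν) (pentagonalSeries ℤ) else 0 := by
  have hle : ∀ r, ν r ≤ N := fun r ↦
    (single_le_sum (fun _ _ ↦ Nat.zero_le _) (mem_univ r)).trans_eq (mem_finsuppAntidiag.1 hν).1
  split_ifs with hw
  · have hlow := choose_le_weight hν
    obtain ⟨g, hg⟩ := exists_pow_five_mul_abacusTerm (K := 7 * n)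
      (le_of_weight_le hν hw hN.ge) fun r ↦ by have := hle r; omega
    rw [hg, mul_left_comm, coeff_X_pow_mul', if_pos hw, mul_add, mul_one, map_add, mul_left_comm,
      coeff_X_pow_mul', if_neg (by omega), add_zero]
  · have := X_pow_weight_dvd_abacusTerm (K := 7 * n) (ν := ν) fun r ↦ by have := hle r; omega
    exact X_pow_dvd_iff.1 ((this.mul_left _).mul_left _) _ (not_le.1 hw)

theorem coreSeries_mul_pentagonalSeries :
    coreSeries * pentagonalSeries ℤ = expand 5 (by norm_num) (pentagonalSeries ℤ) ^ 5 := by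
  ext n
  obtain ⟨N, hN⟩ : ∃ N, N = 6 * n := ⟨_, rfl⟩
  set T := (finsuppAntidiag univ N : Finset (Fin 5 →₀ ℕ))
  have hsum : coeff N (qProd (X : ℤ⟦X⟧) (5 * (7 * n))) = ∑ ν ∈ T, abacusTerm (7 * n) ν :=
    coeff_qProd_five_mul X N (7 * n)
  obtain ⟨g, hg⟩ := exists_pentagonalSeries_mul_coeff_qProd (n := n) (N := N)
    (K := 5 * (7 * n)) (by omega) (by omega)
  have hmain : coeff n (expand 5 (by norm_num) (pentagonalSeries ℤ) ^ 5) =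
      ∑ ν ∈ T, if weight ν ≤ N.choose 2 + n then
        coeff (N.choose 2 + n - weight ν) (pentagonalSeries ℤ) else 0 := by
    rw [← sum_congr rfl fun ν hν ↦ coeff_mul_abacusTerm hN hν, ← map_sum, ← mul_sum, ← mul_sum,
      ← hsum, mul_left_comm, hg, mul_left_comm, coeff_X_pow_mul', if_pos (Nat.le_add_right _ _),
      Nat.add_sub_cancel_left, mul_add, mul_one, map_add, mul_left_comm, coeff_X_pow_mul',
      if_neg (by omega), add_zero]
  rw [hmain, ← sum_filter, coeff_mul, Nat.sum_antidiagonal_eq_sum_range_succ_mk,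
    ← sum_fiberwise_of_maps_to (t := range (n + 1))
      (g := fun ν : Fin 5 →₀ ℕ ↦ weight ν - N.choose 2)]
  · refine sum_congr rfl fun j hj ↦ ?_
    rw [mem_range] at hj
    rw [coreSeries, coeff_mk, coreCount_five_eq (by omega : j ≤ N), ← nsmul_eq_mul, ← sum_const,
      filter_filter]
    refine sum_congr ?_ ?_
    · refine filter_congr fun ν hν ↦ ?_
      have := choose_le_weight hν
      omega
    · intro ν hν
      obtain ⟨h1, h2⟩ := mem_filter.1 hν
      have := choose_le_weight h1
      congr 2
      dsimp only
      omega
  · intro ν hν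
    have := choose_le_weight (mem_filter.1 hν).1
    have := (mem_filter.1 hν).2
    rw [mem_range]
    omega

/-- Tuples of `t`-cores of total size `n`, sorted by the sizes of the components. -/
def tupleEquiv (t k n : ℕ) :
    {f : Fin k → Σ m : Fin (n + 1), Nat.Partition (m : ℕ) //
      (∑ i, ((f i).1 : ℕ)) = n ∧ ∀ i, IsTCore t (f i).2} ≃
    Σ l : {l : Fin k → ℕ // ∑ i, l i = n}, ∀ i, {p : (l.1 i).Partition // IsTCore t p} where
  toFun f := ⟨⟨fun i ↦ (f.1 i).1, f.2.1⟩, fun i ↦ ⟨(f.1 i).2, f.2.2 i⟩⟩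
  invFun s := ⟨fun i ↦ ⟨⟨s.1.1 i, Nat.lt_succ_of_le
    ((single_le_sum (fun _ _ ↦ Nat.zero_le _) (mem_univ i)).trans_eq s.1.2)⟩, (s.2 i).1⟩,
    s.1.2, fun i ↦ (s.2 i).2⟩
  left_inv _ := rfl
  right_inv _ := rfl

theorem numA_eq_sum (t k n : ℕ) :
    numA t k n =
      ∑ l ∈ (finsuppAntidiag univ n : Finset (Fin k →₀ ℕ)), ∏ i, coreCount t (l i) := by
  let e : {l : Fin k → ℕ // ∑ i, l i = n} ≃ (finsuppAntidiag univ n : Finset (Fin k →₀ ℕ)) :=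
    Finsupp.equivFunOnFinite.symm.subtypeEquiv fun l ↦ by simp
  let _ : Fintype {l : Fin k → ℕ // ∑ i, l i = n} := Fintype.ofEquiv _ e.symm
  rw [numA, Nat.card_congr (tupleEquiv t k n), Nat.card_sigma,
    ← sum_coe_sort (finsuppAntidiag univ n), ← e.sum_comp]
  refine sum_congr rfl fun l _ ↦ ?_
  rw [Nat.card_pi]
  rfl

theorem coe_numA_five_four (n : ℕ) : (numA 5 4 n : ℤ) = coeff n (coreSeries ^ 4) := by
  rw [show coreSeries ^ 4 = ∏ _i : Fin 4, coreSeries by simp, coeff_prod, numA_eq_sum]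
  simp [coreSeries]

end FiveCore

theorem stmt_7 : ∀ n : ℕ, 3125 ∣ numA 5 4 (25 * n + 21) := by
  intro n
  have h := FiveCore.dvd_coeff_pow_four FiveCore.coreSeries_mul_pentagonalSeries n
  rw [← FiveCore.coe_numA_five_four] at h
  exact_mod_cast h
end
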